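/- arXiv:1609.04616 — 3 statements merged into one kernel-verified Lean document; each statement's English description precedes it below -/
import Mathlib

section
/- Let q ≥ 1 be an integer and let (s_j)_{j=0}^∞ be a Stieltjes positive definite sequence of complex q×q matrices with Stieltjes parametrization (𝔮_j)_{j=0}^∞. Then for every k ∈ ℕ₀, the Stieltjes parametrization (𝔮_j^{(k)})_{j=0}^∞ of the k-th Kátětov transform (s_j^{(k)})_{j=0}^∞ satisfies 𝔮_j^{(k)} = 𝔮_{k+j} for all j ∈ ℕ₀. -/
open Matrix
open scoped ComplexOrder

noncomputable section

/-- The space of complex `q × q` matrices. -/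
abbrev Mq (q : ℕ) := Matrix (Fin q) (Fin q) ℂ

/-- The space of complex `2q × 2q` matrices, written in `q × q` blocks. -/
abbrev M2q (q : ℕ) := Matrix (Fin q ⊕ Fin q) (Fin q ⊕ Fin q) ℂ

/-- Block Hankel matrix `H_n = (s_{j+k})_{j,k=0}^n`. -/
def Hmat (q : ℕ) (s : ℕ → Mq q) (n : ℕ) :
    Matrix (Fin (n + 1) × Fin q) (Fin (n + 1) × Fin q) ℂ :=
  Matrix.of fun p r => s (p.1.1 + r.1.1) p.2 r.2

/-- Block Hankel matrix `K_n = (s_{j+k+1})_{j,k=0}^n`. -/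
def Kmat (q : ℕ) (s : ℕ → Mq q) (n : ℕ) :
    Matrix (Fin (n + 1) × Fin q) (Fin (n + 1) × Fin q) ℂ :=
  Matrix.of fun p r => s (p.1.1 + r.1.1 + 1) p.2 r.2

/-- A sequence of complex `q × q` matrices is Stieltjes positive definite if all the
block Hankel matrices `H_n` and `K_n` are positive definite (in particular Hermitian). -/
def IsStieltjesPD (q : ℕ) (s : ℕ → Mq q) : Prop :=
  ∀ n : ℕ, (Hmat q s n).PosDef ∧ (Kmat q s n).PosDef

/-- Even Stieltjes parameters `𝔮_{2k}` (Schur complements `L_k`). -/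
def qEven (q : ℕ) (s : ℕ → Mq q) : ℕ → Mq q
  | 0 => s 0
  | k + 1 =>
      s (2 * (k + 1)) -
        (Matrix.of fun (a : Fin q) (r : Fin (k + 1) × Fin q) => s (k + 1 + r.1.1) a r.2) *
          (Hmat q s k)⁻¹ *
          (Matrix.of fun (p : Fin (k + 1) × Fin q) (b : Fin q) => s (k + 1 + p.1.1) p.2 b)

/-- Odd Stieltjes parameters `𝔮_{2k+1}` (Schur complements `Λ_k`). -/
def qOdd (q : ℕ) (s : ℕ → Mq q) : ℕ → Mq q
  | 0 => s 1
  | k + 1 =>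
      s (2 * (k + 1) + 1) -
        (Matrix.of fun (a : Fin q) (r : Fin (k + 1) × Fin q) => s (k + 2 + r.1.1) a r.2) *
          (Kmat q s k)⁻¹ *
          (Matrix.of fun (p : Fin (k + 1) × Fin q) (b : Fin q) => s (k + 2 + p.1.1) p.2 b)

/-- Stieltjes parametrization `𝔮_j`. -/
def qpar (q : ℕ) (s : ℕ → Mq q) (j : ℕ) : Mq q :=
  if j % 2 = 0 then qEven q s (j / 2) else qOdd q s (j / 2)

/-- Reciprocal sequence `s^♯`. -/
def reciprocal (q : ℕ) (s : ℕ → Mq q) : ℕ → Mq q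
  | 0 => (s 0)⁻¹
  | j + 1 =>
      -(s 0)⁻¹ *
        ∑ l ∈ (Finset.range (j + 1)).attach, s (j + 1 - l.1) * reciprocal q s l.1
  decreasing_by exact Finset.mem_range.mp l.2

/-- First Kátětov transform `s^{(1)}_j = −s_0 s_{j+1}^♯ s_0`. -/
def katetov1 (q : ℕ) (s : ℕ → Mq q) : ℕ → Mq q :=
  fun j => -(s 0) * reciprocal q s (j + 1) * s 0

/-- `ℓ`-th Kátětov transform (the `ℓ`-fold iterate of the first Kátětov transform). -/
def katetov (q : ℕ) (ℓ : ℕ) (s : ℕ → Mq q) : ℕ → Mq q :=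
  (katetov1 q)^[ℓ] s

/-- `v_k = col(I_q, 0_{kq×q})`. -/
def vcol (q k : ℕ) : Matrix (Fin (k + 1) × Fin q) (Fin q) ℂ :=
  Matrix.of fun p b => if p.1.1 = 0 ∧ p.2 = b then 1 else 0

/-- `y_{0,k} = col(s_0, …, s_k)`. -/
def ycol (q : ℕ) (s : ℕ → Mq q) (k : ℕ) : Matrix (Fin (k + 1) × Fin q) (Fin q) ℂ :=
  Matrix.of fun p b => s p.1.1 p.2 b

/-- Dyukarev–Stieltjes parameters `𝔐_k`. -/
def DSM (q : ℕ) (s : ℕ → Mq q) : ℕ → Mq q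
  | 0 => (s 0)⁻¹
  | k + 1 =>
      (vcol q (k + 1))ᴴ * (Hmat q s (k + 1))⁻¹ * vcol q (k + 1) -
        (vcol q k)ᴴ * (Hmat q s k)⁻¹ * vcol q k

/-- Dyukarev–Stieltjes parameters `𝔏_k`. -/
def DSL (q : ℕ) (s : ℕ → Mq q) : ℕ → Mq q
  | 0 => s 0 * (s 1)⁻¹ * s 0
  | k + 1 =>
      (ycol q s (k + 1))ᴴ * (Kmat q s (k + 1))⁻¹ * ycol q s (k + 1) -
        (ycol q s k)ᴴ * (Kmat q s k)⁻¹ * ycol q s k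

/-- Ordered product `A_0 A_1 ⋯ A_n`. -/
def oprod {α : Type*} [Monoid α] (f : ℕ → α) (n : ℕ) : α :=
  ((List.range (n + 1)).map f).prod

/-- Block shift `T_n = (δ_{j,k+1} I_q)_{j,k=0}^n`. -/
def Tmat (q n : ℕ) : Matrix (Fin (n + 1) × Fin q) (Fin (n + 1) × Fin q) ℂ :=
  Matrix.of fun p r => if p.1.1 = r.1.1 + 1 ∧ p.2 = r.2 then 1 else 0

/-- `R_n(z) = (I_{(n+1)q} − z T_n)⁻¹`. -/
def Rmat (q n : ℕ) (z : ℂ) : Matrix (Fin (n + 1) × Fin q) (Fin (n + 1) × Fin q) ℂ :=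
  (1 - z • Tmat q n)⁻¹

/-- `u_0 = 0`, `u_n = col(0_{q×q}, −y_{0,n−1})`. -/
def ucol (q : ℕ) (s : ℕ → Mq q) (n : ℕ) : Matrix (Fin (n + 1) × Fin q) (Fin q) ℂ :=
  Matrix.of fun p b => if p.1.1 = 0 then 0 else -(s (p.1.1 - 1) p.2 b)

/-- `col(−H_n⁻¹ y_{n+1,2n+1}, I_q)` of size `(n+2)q × q`. -/
def colH (q : ℕ) (s : ℕ → Mq q) (n : ℕ) : Matrix (Fin (n + 2) × Fin q) (Fin q) ℂ :=
  Matrix.of fun p b =>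
    if h : p.1.1 < n + 1 then
      (-((Hmat q s n)⁻¹ *
          Matrix.of fun (r : Fin (n + 1) × Fin q) (c : Fin q) => s (n + 1 + r.1.1) r.2 c))
        (⟨p.1.1, h⟩, p.2) b
    else if p.2 = b then 1 else 0

/-- `col(−K_n⁻¹ y_{n+2,2n+2}, I_q)` of size `(n+2)q × q`. -/
def colK (q : ℕ) (s : ℕ → Mq q) (n : ℕ) : Matrix (Fin (n + 2) × Fin q) (Fin q) ℂ :=
  Matrix.of fun p b =>
    if h : p.1.1 < n + 1 then
      (-((Kmat q s n)⁻¹ *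
          Matrix.of fun (r : Fin (n + 1) × Fin q) (c : Fin q) => s (n + 2 + r.1.1) r.2 c))
        (⟨p.1.1, h⟩, p.2) b
    else if p.2 = b then 1 else 0

/-- `z_{0,n} = row(s_0, …, s_n)`. -/
def zrow (q : ℕ) (s : ℕ → Mq q) (n : ℕ) : Matrix (Fin q) (Fin (n + 1) × Fin q) ℂ :=
  Matrix.of fun a r => s r.1.1 a r.2

/-- Orthogonal matrix polynomials `P_n`. -/
def Ppoly (q : ℕ) (s : ℕ → Mq q) : ℕ → ℂ → Mq q
  | 0, _ => 1
  | n + 1, z => (vcol q (n + 1))ᴴ * (Rmat q (n + 1) (starRingEnd ℂ z))ᴴ * colH q s n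

/-- Second kind matrix polynomials `Q_n`. -/
def Qpoly (q : ℕ) (s : ℕ → Mq q) : ℕ → ℂ → Mq q
  | 0, _ => 0
  | n + 1, z => -((ucol q s (n + 1))ᴴ * (Rmat q (n + 1) (starRingEnd ℂ z))ᴴ * colH q s n)

/-- Matrix polynomials `P̂_n`. -/
def Phat (q : ℕ) (s : ℕ → Mq q) : ℕ → ℂ → Mq q
  | 0, _ => 1
  | n + 1, z => (vcol q (n + 1))ᴴ * (Rmat q (n + 1) (starRingEnd ℂ z))ᴴ * colK q s n

/-- Matrix polynomials `Q̂_n`. -/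
def Qhat (q : ℕ) (s : ℕ → Mq q) : ℕ → ℂ → Mq q
  | 0, _ => s 0
  | n + 1, z => zrow q s (n + 1) * (Rmat q (n + 1) (starRingEnd ℂ z))ᴴ * colK q s n

/-- `α_n(z)`. -/
def alphaP (q : ℕ) (s : ℕ → Mq q) (n : ℕ) (z : ℂ) : Mq q :=
  1 - z • ((ucol q s n)ᴴ * (Rmat q n (starRingEnd ℂ z))ᴴ * (Hmat q s n)⁻¹ * vcol q n)

/-- `γ_n(z)`. -/
def gammaP (q : ℕ) (s : ℕ → Mq q) (n : ℕ) (z : ℂ) : Mq q :=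
  -(z • ((vcol q n)ᴴ * (Rmat q n (starRingEnd ℂ z))ᴴ * (Hmat q s n)⁻¹ * vcol q n))

/-- `β_n(z)`. -/
def betaP (q : ℕ) (s : ℕ → Mq q) : ℕ → ℂ → Mq q
  | 0, _ => 0
  | n + 1, z => (ycol q s n)ᴴ * (Rmat q n (starRingEnd ℂ z))ᴴ * (Kmat q s n)⁻¹ * ycol q s n

/-- `δ_n(z)`. -/
def deltaP (q : ℕ) (s : ℕ → Mq q) : ℕ → ℂ → Mq q
  | 0, _ => 1
  | n + 1, z =>
      1 + z • ((vcol q n)ᴴ * (Rmat q n (starRingEnd ℂ z))ᴴ * (Kmat q s n)⁻¹ * ycol q s n)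

/-- The resolvent matrices `U_m(z)`. -/
def Umat (q : ℕ) (s : ℕ → Mq q) (m : ℕ) (z : ℂ) : M2q q :=
  if m % 2 = 0 then
    Matrix.fromBlocks (alphaP q s (m / 2) z) (betaP q s (m / 2) z)
      (gammaP q s (m / 2) z) (deltaP q s (m / 2) z)
  else
    Matrix.fromBlocks (alphaP q s (m / 2) z) (betaP q s (m / 2 + 1) z)
      (gammaP q s (m / 2) z) (deltaP q s (m / 2 + 1) z)

/-- `𝕄_k(z) = [[I, 0], [−z𝔐_k, I]]`. -/
def MM (q : ℕ) (s : ℕ → Mq q) (k : ℕ) (z : ℂ) : M2q q :=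
  Matrix.fromBlocks 1 0 (-(z • DSM q s k)) 1

/-- `𝕃_k = [[I, 𝔏_k], [0, I]]`. -/
def LL (q : ℕ) (s : ℕ → Mq q) (k : ℕ) : M2q q :=
  Matrix.fromBlocks 1 (DSL q s k) 0 1

/-- `𝒫_n = diag([P_n(0)]^{−*}, P_n(0))`. -/
def PPmat (q : ℕ) (s : ℕ → Mq q) (n : ℕ) : M2q q :=
  Matrix.fromBlocks (((Ppoly q s n 0)⁻¹)ᴴ) 0 0 (Ppoly q s n 0)

/-- `𝐐_n(z) = [[0, Q̂_n(0)], [−z[Q̂_n(0)]^{−*}, 0]]`. -/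
def QQgen (q : ℕ) (s : ℕ → Mq q) (n : ℕ) (z : ℂ) : M2q q :=
  Matrix.fromBlocks 0 (Qhat q s n 0) (-(z • ((Qhat q s n 0)⁻¹)ᴴ)) 0

/-- `𝐐_0^{(ℓ)}(z) = [[0, s_0^{(ℓ)}], [−z(s_0^{(ℓ)})⁻¹, 0]]`. -/
def QQ0 (q : ℕ) (s : ℕ → Mq q) (ℓ : ℕ) (z : ℂ) : M2q q :=
  Matrix.fromBlocks 0 (katetov q ℓ s 0) (-(z • (katetov q ℓ s 0)⁻¹)) 0

/-- `𝒬_m(z) = 𝐐_0^{(0)}(z) ⋯ 𝐐_0^{(m)}(z)`. -/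
def Qprod (q : ℕ) (s : ℕ → Mq q) (m : ℕ) (z : ℂ) : M2q q :=
  oprod (fun ℓ => QQ0 q s ℓ z) m

open Finset in
theorem aux_F {R : Type*} [Ring R] (s t : ℕ → R) (u : R) (hu : u * s 0 = 1)
    (h1 : ∀ j, s (j + 1) = ∑ l ∈ range (j + 1), s (j - l) * u * t l)
    (h2 : ∀ j, s (j + 1) = ∑ l ∈ range (j + 1), t l * u * s (j - l)) :
    (∀ j i, s (i + j + 1) = ∑ k ∈ range (i + 1), ∑ l ∈ range (j + 1),
      s (i - k) * u * t (k + l) * (u * s (j - l))) ∧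
    (∀ i j, s (i + j + 2) = s (i + 1) * u * s (j + 1) +
      ∑ k ∈ range (i + 1), ∑ l ∈ range (j + 1),
      s (i - k) * u * t (k + l + 1) * (u * s (j - l))) := by
  have e1 : ∀ i j, ∑ k ∈ range (i + 1 + 1), ∑ l ∈ range (j + 1),
      s (i + 1 - k) * u * t (k + l) * (u * s (j - l)) = s (i + 1) * u * s (j + 1) +
      ∑ k ∈ range (i + 1), ∑ l ∈ range (j + 1),
      s (i - k) * u * t (k + l + 1) * (u * s (j - l)) := by
    intro i j
    rw [sum_range_succ', add_comm]
    congr 1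
    · rw [h2 j, mul_sum]
      refine sum_congr rfl fun l _ => ?_
      simp [mul_assoc]
    · refine sum_congr rfl fun k _ => sum_congr rfl fun l _ => ?_
      rw [show i + 1 - (k + 1) = i - k by omega, show k + 1 + l = k + l + 1 by omega]
  have e2 : ∀ i j, ∑ k ∈ range (i + 1), ∑ l ∈ range (j + 1 + 1),
      s (i - k) * u * t (k + l) * (u * s (j + 1 - l)) = s (i + 1) * u * s (j + 1) +
      ∑ k ∈ range (i + 1), ∑ l ∈ range (j + 1),
      s (i - k) * u * t (k + l + 1) * (u * s (j - l)) := by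
    intro i j
    rw [h1 i, sum_mul, sum_mul, ← sum_add_distrib]
    refine sum_congr rfl fun k _ => ?_
    rw [sum_range_succ', add_comm]
    congr 1
    · simp [mul_assoc]
    · refine sum_congr rfl fun l _ => ?_
      rw [show j + 1 - (l + 1) = j - l by omega, show k + (l + 1) = k + l + 1 by omega]
  have f : (∀ j i, s (i + j + 1) = ∑ k ∈ range (i + 1), ∑ l ∈ range (j + 1),
      s (i - k) * u * t (k + l) * (u * s (j - l))) := by
    intro j
    induction j with
    | zero =>
      intro i
      simp [hu, h1 i]
    | succ j ih =>
      intro i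
      rw [e2, ← e1, ← ih (i + 1)]
      congr 1; omega
  refine ⟨f, fun i j => ?_⟩
  rw [← e1, ← f]
  congr 1; omega

/-- Toeplitz left factor. -/
def Lf {R : Type*} [Ring R] (s : ℕ → R) (u : R) (i k : ℕ) : R :=
  if k ≤ i then s (i - k) * u else 0

/-- Toeplitz right factor. -/
def Uf {R : Type*} [Ring R] (s : ℕ → R) (u : R) (l j : ℕ) : R :=
  if l ≤ j then u * s (j - l) else 0

open Finset in
theorem aux_trunc {R : Type*} [Ring R] (s : ℕ → R) (u : R) (B : ℕ → ℕ → R) (n i j : ℕ)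
    (hi : i ≤ n) (hj : j ≤ n) :
    ∑ k ∈ range (n + 1), ∑ l ∈ range (n + 1), Lf s u i k * B k l * Uf s u l j =
    ∑ k ∈ range (i + 1), ∑ l ∈ range (j + 1), s (i - k) * u * B k l * (u * s (j - l)) := by
  symm
  refine sum_subset_zero_on_sdiff (by intro x; simp; omega) ?_ ?_
  · intro k hk
    simp only [mem_sdiff, mem_range] at hk
    refine sum_eq_zero fun l _ => ?_
    rw [Lf, if_neg (by omega)]; simp
  · intro k hk
    refine sum_subset_zero_on_sdiff (by intro x; simp; omega) ?_ ?_
    · intro l hl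
      simp only [mem_sdiff, mem_range] at hl
      rw [Uf, if_neg (by omega)]; simp
    · intro l hl
      simp only [mem_range] at hl hk
      rw [Uf, Lf, if_pos (by omega), if_pos (by omega)]

/-- block diagonal `diag(s_0, K_t)`. -/
def Df {R : Type*} [Ring R] (a : R) (t : ℕ → R) : ℕ → ℕ → R
  | 0, 0 => a
  | 0, _ + 1 => 0
  | _ + 1, 0 => 0
  | k + 1, l + 1 => t (k + l + 1)

open Finset in
theorem aux_D {R : Type*} [Ring R] (s t : ℕ → R) (u : R) (hu : u * s 0 = 1)
    (hu' : s 0 * u = 1)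
    (hG : ∀ i j, s (i + j + 2) = s (i + 1) * u * s (j + 1) +
      ∑ k ∈ range (i + 1), ∑ l ∈ range (j + 1),
      s (i - k) * u * t (k + l + 1) * (u * s (j - l))) (i j : ℕ) :
    s (i + j) = ∑ k ∈ range (i + 1), ∑ l ∈ range (j + 1),
      s (i - k) * u * Df (s 0) t k l * (u * s (j - l)) := by
  have e : ∀ j, s 0 * (u * s j) = s j := fun j => by rw [← mul_assoc, hu', one_mul]
  have e' : ∀ j, u * (s 0 * s j) = s j := fun j => by rw [← mul_assoc, hu, one_mul]
  rw [sum_range_succ']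
  simp only [sum_range_succ' _ j]
  cases i with
  | zero => simp [Df, mul_assoc, e]
  | succ i =>
    cases j with
    | zero => simp [Df, mul_assoc, hu]
    | succ j =>
      have := hG i j
      rw [show i + 1 + (j + 1) = i + j + 2 by omega, this]
      simp [Df, mul_assoc, e]
      rw [add_comm]

/-- block Schur complement characterization. -/
def IsSch {R : Type*} [Ring R] (n : ℕ) (A : ℕ → ℕ → R) (Q : R) : Prop :=
  ∃ c : ℕ → R, c n = 1 ∧ (∀ j < n, ∑ k ∈ Finset.range (n + 1), A j k * c k = 0) ∧
    ∑ k ∈ Finset.range (n + 1), A n k * c k = Q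

open Finset in
theorem IsSch.transfer {R : Type*} [Ring R] {n : ℕ} {A B : ℕ → ℕ → R} {Q : R}
    (h : IsSch n A Q) (s : ℕ → R) (u : R) (hu : u * s 0 = 1)
    (hu' : s 0 * u = 1)
    (hA : ∀ i j, i ≤ n → j ≤ n → A i j = ∑ k ∈ range (n + 1), ∑ l ∈ range (n + 1),
      Lf s u i k * B k l * Uf s u l j) : IsSch n B Q := by
  obtain ⟨c, c1, c0, cQ⟩ := h
  let d : ℕ → R := fun l => ∑ j ∈ range (n + 1), Uf s u l j * c j
  let w : ℕ → R := fun k => ∑ l ∈ range (n + 1), B k l * d l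
  have key : ∀ i ≤ n, ∑ j ∈ range (n + 1), A i j * c j = ∑ k ∈ range (n + 1), Lf s u i k * w k := by
    intro i hi
    have : ∑ j ∈ range (n + 1), A i j * c j = ∑ j ∈ range (n + 1),
      ∑ k ∈ range (n + 1), ∑ l ∈ range (n + 1), Lf s u i k * B k l * Uf s u l j * c j := by
      refine sum_congr rfl fun j hj => ?_
      rw [hA i j hi (by simp at hj; omega)]
      simp only [sum_mul]
    rw [this, sum_comm]
    refine sum_congr rfl fun k _ => ?_
    simp only [w, d, mul_sum]
    rw [sum_comm]
    simp only [mul_assoc]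
  have lw : ∀ i ≤ n, (∀ k < i, w k = 0) → ∑ k ∈ range (n + 1), Lf s u i k * w k = w i := by
    intro i hi hk
    rw [sum_eq_single i]
    · simp [Lf, hu']
    · intro b _ hb
      rcases lt_or_gt_of_ne hb with h | h
      · rw [hk b h, mul_zero]
      · rw [Lf, if_neg (by omega), zero_mul]
    · intro h; simp at h; omega
  have w0 : ∀ i, i < n → w i = 0 := by
    intro i
    induction i using Nat.strong_induction_on with
    | _ i ih =>
      intro hi
      rw [← lw i hi.le (fun k hk => ih k hk (by omega)), ← key i hi.le, c0 i hi]
  refine ⟨d, ?_, w0, ?_⟩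
  · change ∑ j ∈ range (n + 1), Uf s u n j * c j = 1
    rw [sum_eq_single n]
    · simp [Uf, hu, c1]
    · intro b hb hbn
      simp at hb
      rw [Uf, if_neg (by omega), zero_mul]
    · simp
  · change w n = Q
    rw [← lw n le_rfl w0, ← key n le_rfl, cQ]

theorem IsSch.drop {R : Type*} [Ring R] {n : ℕ} {a : R} {t : ℕ → R} {Q : R}
    (h : IsSch (n + 1) (Df a t) Q) : IsSch n (fun i j => t (i + j + 1)) Q := by
  obtain ⟨c, c1, c0, cQ⟩ := h
  refine ⟨fun k => c (k + 1), c1, fun j hj => ?_, ?_⟩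
  · have := c0 (j + 1) (by omega)
    rw [Finset.sum_range_succ'] at this
    simpa [Df] using this
  · rw [Finset.sum_range_succ'] at cQ
    simpa [Df] using cQ

theorem aux_recip (q : ℕ) (s : ℕ → Mq q) (h : s 0 * (s 0)⁻¹ = 1) :
    PowerSeries.mk s * PowerSeries.mk (reciprocal q s) = 1 := by
  ext1 n
  rw [PowerSeries.coeff_mul, Finset.Nat.sum_antidiagonal_eq_sum_range_succ_mk,
    ← Finset.sum_range_reflect]
  simp only [PowerSeries.coeff_mk, PowerSeries.coeff_one]
  cases n with
  | zero => simp [reciprocal, h]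
  | succ n =>
    have e : ∀ f : ℕ → ℕ → Mq q, ∑ j ∈ Finset.range (n + 1).succ,
        f ((n + 1).succ - 1 - j) (n + 1 - ((n + 1).succ - 1 - j)) =
        ∑ j ∈ Finset.range (n + 2), f (n + 1 - j) j := by
      intro f
      refine Finset.sum_congr rfl fun j hj => ?_
      simp at hj
      congr 1
      omega
    rw [e (fun a b => s a * reciprocal q s b), Finset.sum_range_succ]
    have : s 0 * reciprocal q s (n + 1) =
        - ∑ l ∈ Finset.range (n + 1), s (n + 1 - l) * reciprocal q s l := by
      rw [reciprocal, ← mul_assoc, mul_neg, h,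
        Finset.sum_attach _ (fun l => s (n + 1 - l) * reciprocal q s l)]
      simp
    simp [this]

theorem aux_recip' (q : ℕ) (s : ℕ → Mq q) (h : s 0 * (s 0)⁻¹ = 1) (h' : (s 0)⁻¹ * s 0 = 1) :
    PowerSeries.mk (reciprocal q s) * PowerSeries.mk s = 1 := by
  have a := aux_recip q s h
  have b := aux_recip q (reciprocal q s) (by
    rw [reciprocal, Matrix.nonsing_inv_nonsing_inv _ (Matrix.isUnit_det_of_left_inverse h'), h'])
  rwa [← left_inv_eq_right_inv a b] at b

theorem aux_h1 (q : ℕ) (s : ℕ → Mq q) (h : s 0 * (s 0)⁻¹ = 1) (h' : (s 0)⁻¹ * s 0 = 1) (j : ℕ) :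
    s (j + 1) = ∑ l ∈ Finset.range (j + 1), s (j - l) * (s 0)⁻¹ * katetov1 q s l := by
  have a := congrArg (PowerSeries.coeff (j + 1)) (aux_recip q s h)
  rw [PowerSeries.coeff_mul, ← Finset.Nat.sum_antidiagonal_swap,
    Finset.Nat.sum_antidiagonal_eq_sum_range_succ_mk, Finset.sum_range_succ'] at a
  have r0 : reciprocal q s 0 = (s 0)⁻¹ := by rw [reciprocal]
  simp [PowerSeries.coeff_one, r0] at a
  have e : ∀ l, s (j - l) * (s 0)⁻¹ * katetov1 q s l = - (s (j - l) * reciprocal q s (l + 1) * s 0) := by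
    intro l
    simp only [katetov1, neg_mul, mul_neg, mul_assoc]
    rw [← mul_assoc (s 0)⁻¹, h', one_mul]
  simp only [e, Finset.sum_neg_distrib]
  rw [← Finset.sum_mul, eq_neg_of_add_eq_zero_left a]
  simp [mul_assoc, h']

theorem aux_h2 (q : ℕ) (s : ℕ → Mq q) (h : s 0 * (s 0)⁻¹ = 1) (h' : (s 0)⁻¹ * s 0 = 1) (j : ℕ) :
    s (j + 1) = ∑ l ∈ Finset.range (j + 1), katetov1 q s l * (s 0)⁻¹ * s (j - l) := by
  have a := congrArg (PowerSeries.coeff (j + 1)) (aux_recip' q s h h')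
  rw [PowerSeries.coeff_mul,
    Finset.Nat.sum_antidiagonal_eq_sum_range_succ_mk, Finset.sum_range_succ'] at a
  have r0 : reciprocal q s 0 = (s 0)⁻¹ := by rw [reciprocal]
  simp [PowerSeries.coeff_one, r0] at a
  have e : ∀ l, katetov1 q s l * (s 0)⁻¹ * s (j - l) = - (s 0 * (reciprocal q s (l + 1) * s (j - l))) := by
    intro l
    simp only [katetov1, neg_mul, mul_assoc]
    rw [← mul_assoc (s 0) (s 0)⁻¹, h, one_mul]
  simp only [e, Finset.sum_neg_distrib]
  rw [← Finset.mul_sum, eq_neg_of_add_eq_zero_left a]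
  simp [← mul_assoc, h]

/-- Flattening of a block array. -/
def toMat (q n : ℕ) (A : ℕ → ℕ → Mq q) :
    Matrix (Fin (n + 1) × Fin q) (Fin (n + 1) × Fin q) ℂ :=
  Matrix.of fun p r => A p.1.1 r.1.1 p.2 r.2

theorem toMat_mul (q n : ℕ) (A B : ℕ → ℕ → Mq q) :
    toMat q n A * toMat q n B =
      toMat q n (fun i j => ∑ k ∈ Finset.range (n + 1), A i k * B k j) := by
  ext p r
  simp only [toMat, Matrix.mul_apply, Matrix.of_apply, Fintype.sum_prod_type, Finset.sum_range,
    Matrix.sum_apply]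

theorem aux_posDef (q n : ℕ) (A B : ℕ → ℕ → Mq q) (s : ℕ → Mq q)
    (hs : ∀ j, (s j)ᴴ = s j)
    (hA : ∀ i j, i ≤ n → j ≤ n → A i j = ∑ k ∈ Finset.range (n + 1), ∑ l ∈ Finset.range (n + 1),
      Lf s (s 0)⁻¹ i k * B k l * Uf s (s 0)⁻¹ l j) (h : (toMat q n A).PosDef) :
    (toMat q n B).PosDef := by
  have hU : toMat q n (Uf s (s 0)⁻¹) = (toMat q n (Lf s (s 0)⁻¹))ᴴ := by
    have : ∀ i j, Uf s (s 0)⁻¹ i j = (Lf s (s 0)⁻¹ j i)ᴴ := by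
      intro i j
      unfold Uf Lf
      split_ifs
      · rw [Matrix.conjTranspose_mul, Matrix.conjTranspose_nonsing_inv, hs, hs]
      · simp
    ext p r
    simp [toMat, this]
  have e : toMat q n A = toMat q n (Lf s (s 0)⁻¹) * toMat q n B * (toMat q n (Lf s (s 0)⁻¹))ᴴ := by
    rw [← hU, toMat_mul, toMat_mul]
    ext p r
    simp only [toMat, Matrix.of_apply]
    rw [hA _ _ (by omega) (by omega), Finset.sum_comm]
    simp only [Finset.sum_mul]
  rw [e] at h
  have hu : IsUnit (toMat q n (Lf s (s 0)⁻¹)) := by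
    have := h.isUnit
    rw [Matrix.isUnit_iff_isUnit_det, Matrix.det_mul, Matrix.det_mul, mul_assoc] at this
    rw [Matrix.isUnit_iff_isUnit_det]
    exact isUnit_of_mul_isUnit_left this
  exact (Matrix.IsUnit.posDef_star_right_conjugate_iff hu).1 h

/-- Explicit Schur complement. -/
def schF (q : ℕ) (A : ℕ → ℕ → Mq q) : ℕ → Mq q
  | 0 => A 0 0
  | m + 1 => A (m + 1) (m + 1) -
      (Matrix.of fun (a : Fin q) (r : Fin (m + 1) × Fin q) => A (m + 1) r.1.1 a r.2) *
        (toMat q m A)⁻¹ *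
        (Matrix.of fun (p : Fin (m + 1) × Fin q) (b : Fin q) => A p.1.1 (m + 1) p.2 b)

theorem aux_col (q m : ℕ) (A : ℕ → ℕ → Mq q) (c : ℕ → Mq q) (p : Fin (m + 1) × Fin q) (b : Fin q) :
    (toMat q m A * (Matrix.of fun (p : Fin (m + 1) × Fin q) (b : Fin q) => c p.1.1 p.2 b)) p b =
    (∑ k ∈ Finset.range (m + 1), A p.1.1 k * c k) p.2 b := by
  simp only [toMat, Matrix.mul_apply, Matrix.of_apply, Fintype.sum_prod_type, Finset.sum_range,
    Matrix.sum_apply]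

theorem aux_row (q m : ℕ) (A : ℕ → Mq q) (c : ℕ → Mq q) :
    (Matrix.of fun (a : Fin q) (r : Fin (m + 1) × Fin q) => A r.1.1 a r.2) *
      (Matrix.of fun (p : Fin (m + 1) × Fin q) (b : Fin q) => c p.1.1 p.2 b) =
    (∑ k ∈ Finset.range (m + 1), A k * c k) := by
  ext a b
  simp only [Matrix.mul_apply, Matrix.of_apply, Fintype.sum_prod_type, Finset.sum_range,
    Matrix.sum_apply]

theorem IsSch.eq (q : ℕ) (A : ℕ → ℕ → Mq q) (h : ∀ n, (toMat q n A).PosDef) (n : ℕ) (Q : Mq q)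
    (hQ : IsSch n A Q) : Q = schF q A n := by
  obtain ⟨c, c1, c0, cQ⟩ := hQ
  cases n with
  | zero => simp [c1] at cQ; exact cQ.symm
  | succ m =>
    set C := (Matrix.of fun (p : Fin (m + 1) × Fin q) (b : Fin q) => c p.1.1 p.2 b) with hC
    set Y := (Matrix.of fun (p : Fin (m + 1) × Fin q) (b : Fin q) => A p.1.1 (m + 1) p.2 b) with hY
    have e : toMat q m A * C = - Y := by
      ext p b
      rw [aux_col]
      have := c0 p.1.1 p.1.2
      rw [Finset.sum_range_succ, c1, mul_one] at this
      rw [eq_neg_of_add_eq_zero_left this]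
      simp [hY]
    have hd := (Matrix.isUnit_iff_isUnit_det _).1 (h m).isUnit
    have e2 : (toMat q m A)⁻¹ * Y = - C := by
      rw [← neg_neg Y, ← e, Matrix.mul_neg, ← Matrix.mul_assoc, Matrix.nonsing_inv_mul _ hd,
        Matrix.one_mul]
    rw [schF, Matrix.mul_assoc, e2, Matrix.mul_neg, aux_row q m (A (m + 1)) c, sub_neg_eq_add,
      ← cQ, Finset.sum_range_succ, c1, mul_one, add_comm]

theorem IsSch.exists (q : ℕ) (A : ℕ → ℕ → Mq q) (h : ∀ n, (toMat q n A).PosDef) (n : ℕ) :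
    IsSch n A (schF q A n) := by
  suffices ∃ Q, IsSch n A Q by
    obtain ⟨Q, hQ⟩ := this
    rwa [← IsSch.eq q A h n Q hQ]
  cases n with
  | zero => exact ⟨_, fun _ => 1, rfl, by simp, rfl⟩
  | succ m =>
    set Y := (Matrix.of fun (p : Fin (m + 1) × Fin q) (b : Fin q) => A p.1.1 (m + 1) p.2 b) with hY
    set C := -((toMat q m A)⁻¹ * Y) with hC
    have hd := (Matrix.isUnit_iff_isUnit_det _).1 (h m).isUnit
    let c : ℕ → Mq q := fun k => if hk : k < m + 1 then Matrix.of fun a b => C (⟨k, hk⟩, a) b else 1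
    have e : toMat q m A * (Matrix.of fun (p : Fin (m + 1) × Fin q) (b : Fin q) => c p.1.1 p.2 b)
        = - Y := by
      have : (Matrix.of fun (p : Fin (m + 1) × Fin q) (b : Fin q) => c p.1.1 p.2 b) = C := by
        ext p b
        simp only [c, Matrix.of_apply, dif_pos p.1.2]
      rw [this, hC, Matrix.mul_neg, ← Matrix.mul_assoc, Matrix.mul_nonsing_inv _ hd,
        Matrix.one_mul]
    have c1 : c (m + 1) = 1 := by simp [c]
    refine ⟨_, c, c1, fun j hj => ?_, rfl⟩
    rw [Finset.sum_range_succ, c1, mul_one]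
    ext a b
    have := congrFun (congrFun e (⟨j, hj⟩, a)) b
    rw [aux_col] at this
    simp only [Matrix.add_apply, this]
    simp [hY]

theorem qEven_eq (q : ℕ) (s : ℕ → Mq q) (n : ℕ) : qEven q s n = schF q (fun i j => s (i + j)) n := by
  cases n with
  | zero => rfl
  | succ m =>
    simp only [qEven, schF, show ∀ p, p + (m + 1) = m + 1 + p from fun p => add_comm _ _, two_mul]
    rfl

theorem qOdd_eq (q : ℕ) (s : ℕ → Mq q) (n : ℕ) :
    qOdd q s n = schF q (fun i j => s (i + j + 1)) n := by
  cases n with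
  | zero => rfl
  | succ m =>
    simp only [qOdd, schF, show ∀ p, p + (m + 1) + 1 = m + 2 + p from fun p => by omega,
      show ∀ p, (m + 1) + p + 1 = m + 2 + p from fun p => by omega,
      show 2 * (m + 1) + 1 = m + 2 + (m + 1) by omega]
    rfl

theorem katetov1_step (q : ℕ) (s : ℕ → Mq q) (hs : IsStieltjesPD q s) :
    IsStieltjesPD q (katetov1 q s) ∧ ∀ j, qpar q (katetov1 q s) j = qpar q s (j + 1) := by
  have herm : ∀ j, (s j)ᴴ = s j := by
    intro j
    ext a b
    have := congrFun (congrFun (hs j).1.isHermitian (⟨j, by omega⟩, a)) (⟨0, by omega⟩, b)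
    simpa [Hmat] using this
  have hs0 : (s 0).PosDef := by
    have := (hs 0).1.submatrix (e := fun a : Fin q => ((0 : Fin 1), a)) (by intro a b; simp)
    exact this
  have hd := (Matrix.isUnit_iff_isUnit_det _).1 hs0.isUnit
  have h := Matrix.mul_nonsing_inv _ hd
  have h' := Matrix.nonsing_inv_mul _ hd
  obtain ⟨hF, hG⟩ := aux_F s (katetov1 q s) (s 0)⁻¹ h' (aux_h1 q s h h') (aux_h2 q s h h')
  have hD := aux_D s (katetov1 q s) (s 0)⁻¹ h' h hG
  have hA1 : ∀ n i j, i ≤ n → j ≤ n → s (i + j + 1) =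
      ∑ k ∈ Finset.range (n + 1), ∑ l ∈ Finset.range (n + 1),
      Lf s (s 0)⁻¹ i k * (fun i j => katetov1 q s (i + j)) k l * Uf s (s 0)⁻¹ l j := by
    intro n i j hi hj
    rw [aux_trunc _ _ _ _ _ _ hi hj]
    exact hF j i
  have hA2 : ∀ n i j, i ≤ n → j ≤ n → s (i + j) =
      ∑ k ∈ Finset.range (n + 1), ∑ l ∈ Finset.range (n + 1),
      Lf s (s 0)⁻¹ i k * Df (s 0) (katetov1 q s) k l * Uf s (s 0)⁻¹ l j := by
    intro n i j hi hj
    rw [aux_trunc _ _ _ _ _ _ hi hj]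
    exact hD i j
  have pH : ∀ n, (toMat q n (fun i j => katetov1 q s (i + j))).PosDef := fun n =>
    aux_posDef q n (fun i j => s (i + j + 1)) _ s herm (hA1 n) (hs n).2
  have pK : ∀ n, (toMat q n (fun i j => katetov1 q s (i + j + 1))).PosDef := fun n => by
    have := aux_posDef q (n + 1) (fun i j => s (i + j)) _ s herm (hA2 (n + 1)) (hs (n + 1)).1
    have := this.submatrix (e := fun p : Fin (n + 1) × Fin q => (p.1.succ, p.2)) (by
      rintro ⟨a, b⟩ ⟨c, d⟩; simp)
    exact this
  have qE : ∀ n, qEven q (katetov1 q s) n = qOdd q s n := by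
    intro n
    rw [qEven_eq, qOdd_eq]
    exact (IsSch.eq q _ pH n _ ((IsSch.exists q (fun i j => s (i + j + 1)) (fun n => (hs n).2) n).transfer
      s _ h' h (hA1 n))).symm
  have qO : ∀ n, qOdd q (katetov1 q s) n = qEven q s (n + 1) := by
    intro n
    rw [qEven_eq, qOdd_eq]
    exact (IsSch.eq q _ pK n _ ((IsSch.exists q (fun i j => s (i + j)) (fun n => (hs n).1) (n + 1)).transfer
      s _ h' h (hA2 (n + 1))).drop).symm
  refine ⟨fun n => ⟨pH n, pK n⟩, fun j => ?_⟩
  unfold qpar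
  rcases Nat.mod_two_eq_zero_or_one j with hj | hj
  · rw [if_pos hj, if_neg (by omega), qE]
    congr 1; omega
  · rw [if_neg (by omega), if_pos (by omega), qO]
    congr 1; omega

/-- The Stieltjes parametrization of the `k`-th Kátětov transform is the `k`-shift of the
Stieltjes parametrization of the original sequence. -/
theorem stmt0 (q : ℕ) (hq : 1 ≤ q) (s : ℕ → Mq q) (hs : IsStieltjesPD q s) (k j : ℕ) :
    qpar q (katetov q k s) j = qpar q s (k + j) := by
  induction k generalizing s j with
  | zero => simp [katetov]
  | succ k ih =>
    have := katetov1_step q s hs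
    have e : katetov q (k + 1) s = katetov q k (katetov1 q s) := rfl
    rw [e, ih _ this.1, this.2]
    congr 1; omega

end
end

section
/- Let q ≥ 1 be an integer and let (s_j)_{j=0}^∞ be a Stieltjes positive definite sequence of complex q×q matrices with Stieltjes parametrization (𝔮_j)_{j=0}^∞. Then for all ℓ ∈ ℕ₀ and k ∈ ℕ₀, the Dyukarev–Stieltjes parameters of the ℓ-th Kátětov transform satisfy 𝔏_k^{(ℓ)} = (∏_{j=0}^{k} 𝔮_{2j+ℓ} 𝔮_{2j+ℓ+1}^{−1}) · 𝔮_{2k+ℓ+1} · (∏_{j=0}^{k} 𝔮_{2j+ℓ} 𝔮_{2j+ℓ+1}^{−1})^*, and 𝔐_0^{(ℓ)} = 𝔮_ℓ^{−1}, while for k ≥ 1: 𝔐_k^{(ℓ)} = (∏_{j=0}^{k−1} 𝔮_{2j+ℓ}^{−1} 𝔮_{2j+ℓ+1}) · 𝔮_{2k+ℓ}^{−1} · (∏_{j=0}^{k−1} 𝔮_{2j+ℓ}^{−1} 𝔮_{2j+ℓ+1})^*. -/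
open Matrix
open scoped ComplexOrder

noncomputable section

section AbstractPart
variable {R : Type*} [Ring R]

/-- Action of the block Hankel matrix on a sequence. -/
def hApp (s : ℕ → R) (m : ℕ) (u : ℕ → R) (i : ℕ) : R :=
  ∑ j ∈ Finset.range m, s (i + j) * u j

/-- Shifted sequence. -/
def sh (s : ℕ → R) : ℕ → R := fun j => s (j + 1)

/-- Nondegeneracy of all the Hankel matrices. -/
def ND (s : ℕ → R) : Prop :=
  ∀ m u, (∀ i < m, hApp s m u i = 0) → ∀ j < m, u j = 0

/-- `w` is the coefficient sequence of the monic orthogonal polynomial with norm `L`. -/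
structure Orth (s : ℕ → R) (k : ℕ) (w : ℕ → R) (L : R) : Prop where
  monic : w k = 1
  orth : ∀ i < k, hApp s (k + 1) w i = 0
  last : hApp s (k + 1) w k = L

theorem hApp_mul (s u : ℕ → R) (m : ℕ) (c : R) (i : ℕ) :
    hApp s m (fun j => u j * c) i = hApp s m u i * c := by
  simp [hApp, Finset.sum_mul, mul_assoc]

theorem hApp_sub (s u v : ℕ → R) (m : ℕ) (i : ℕ) :
    hApp s m (fun j => u j - v j) i = hApp s m u i - hApp s m v i := by
  simp [hApp, mul_sub]

theorem hApp_succ (s u : ℕ → R) (m : ℕ) (i : ℕ) :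
    hApp s (m + 1) u i = hApp s m u i + s (i + m) * u m := by
  simp [hApp, Finset.sum_range_succ]

theorem hApp_sh (s u : ℕ → R) (m : ℕ) (i : ℕ) :
    hApp (sh s) m u i = hApp s m u (i + 1) := by
  unfold hApp sh
  refine Finset.sum_congr rfl fun j _ => ?_
  rw [add_right_comm]

theorem hApp_X (s u : ℕ → R) (m : ℕ) (i : ℕ) :
    hApp s (m + 1) (fun j => if j = 0 then 0 else u (j - 1)) i = hApp (sh s) m u i := by
  unfold hApp sh
  rw [Finset.sum_range_succ']
  simp [add_assoc]

theorem Orth.unit_cancel {s w : ℕ → R} {k : ℕ} {L : R} (hs : ND s) (h : Orth s k w L) (c : R)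
    (hc : L * c = 0) : c = 0 := by
  have := hs (k + 1) (fun j => w j * c) (fun i hi => by
    rw [hApp_mul]
    rcases Nat.lt_succ_iff_lt_or_eq.mp hi with h1 | h1
    · rw [h.orth i h1, zero_mul]
    · rw [h1, h.last, hc]) k (Nat.lt_succ_self k)
  simpa [h.monic] using this

theorem stepP {s w w' W : ℕ → R} {k : ℕ} {L L' M c : R} (hs : ND s) (h : Orth s k w L)
    (h' : Orth (sh s) k w' L') (hW : Orth s (k + 1) W M) (hc : L * c = L') :
    W 0 = -(w 0 * c) := by
  have key := hs (k + 1)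
    (fun j => (if j = 0 then 0 else w' (j - 1)) - W j - w j * c) (fun i hi => by
      rw [hApp_sub s (fun j => (if j = 0 then 0 else w' (j - 1)) - W j) (fun j => w j * c),
        hApp_sub s (fun j => (if j = 0 then 0 else w' (j - 1))) W, hApp_mul]
      have e1 := hApp_X s w' (k + 1) i
      rw [hApp_succ] at e1
      have e2 := hW.orth i hi
      rw [hApp_succ, hW.monic] at e2
      simp only [Nat.succ_ne_zero, if_false, Nat.add_sub_cancel, h'.monic] at e1
      have e3 : hApp (sh s) (k + 1) w' i = hApp s (k + 1) w i * c := by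
        rcases Nat.lt_succ_iff_lt_or_eq.mp hi with h1 | h1
        · rw [h.orth i h1, h'.orth i h1, zero_mul]
        · rw [h1, h.last, h'.last, hc]
      rw [← e3, ← e1, eq_neg_of_add_eq_zero_left e2]
      abel) 0 (Nat.succ_pos k)
  simp only [if_true] at key
  have : -W 0 = w 0 * c := by
    rw [zero_sub] at key; exact sub_eq_zero.mp key
  rw [← this, neg_neg]

theorem stepQ {s w' w'' W : ℕ → R} {k : ℕ} {L' L'' M d : R} (hs : ND (sh s))
    (h' : Orth (sh s) k w' L') (hW : Orth s (k + 1) W M)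
    (h'' : Orth (sh s) (k + 1) w'' L'') (hd : L' * d = M) :
    hApp s (k + 2) w'' 0 = -(hApp s (k + 1) w' 0 * d) := by
  have key := hs (k + 1)
    (fun j => W j - w'' j - w' j * d) (fun i hi => by
      rw [hApp_sub (sh s) (fun j => W j - w'' j) (fun j => w' j * d),
        hApp_sub (sh s) W w'', hApp_mul]
      have e1 := hApp_sh s W (k + 2) i
      rw [hApp_succ, hW.monic] at e1
      have e2 := h''.orth i hi
      rw [hApp_succ, h''.monic] at e2
      have e3 : hApp s (k + 2) W (i + 1) = hApp (sh s) (k + 1) w' i * d := by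
        rcases Nat.lt_succ_iff_lt_or_eq.mp hi with h1 | h1
        · rw [h'.orth i h1, hW.orth (i + 1) (by omega), zero_mul]
        · rw [h1, h'.last, hW.last, hd]
      rw [← e3, ← e1, eq_neg_of_add_eq_zero_left e2]
      abel)
  have e4 : hApp s (k + 1) (fun j => W j - w'' j - w' j * d) 0 = 0 := by
    refine Finset.sum_eq_zero fun j hj => ?_
    simp only [key j (Finset.mem_range.mp hj), mul_zero]
  rw [hApp_sub s (fun j => W j - w'' j) (fun j => w' j * d),
        hApp_sub s W w'', hApp_mul] at e4
  have e5 := hW.orth 0 (Nat.succ_pos k)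
  rw [hApp_succ, hW.monic] at e5
  rw [hApp_succ, h''.monic]
  rw [eq_neg_of_add_eq_zero_left e5] at e4
  have := sub_eq_zero.mp e4
  rw [← this]
  abel

variable [StarRing R]

set_option linter.unusedSectionVars false

theorem hApp_symm {s : ℕ → R} (hs : ∀ j, star (s j) = s j) (u v : ℕ → R) (m : ℕ) :
    ∑ i ∈ Finset.range m, star (u i) * hApp s m v i =
      ∑ i ∈ Finset.range m, star (hApp s m u i) * v i := by
  simp only [hApp, Finset.mul_sum, star_sum, star_mul, Finset.sum_mul, hs]
  rw [Finset.sum_comm]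
  refine Finset.sum_congr rfl fun i _ => Finset.sum_congr rfl fun j _ => ?_
  rw [mul_assoc, add_comm]

theorem Orth.pair {s w : ℕ → R} {k : ℕ} {L : R} (hs : ∀ j, star (s j) = s j)
    (h : Orth s k w L) (x : ℕ → R) :
    ∑ i ∈ Finset.range (k + 1), star (w i) * hApp s (k + 1) x i = star L * x k := by
  rw [hApp_symm hs, Finset.sum_range_succ, h.last, Finset.sum_eq_zero, zero_add]
  intro i hi
  rw [h.orth i (Finset.mem_range.mp hi), star_zero, zero_mul]

theorem Orth.star_eq {s w : ℕ → R} {k : ℕ} {L : R} (hs : ∀ j, star (s j) = s j)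
    (h : Orth s k w L) : star L = L := by
  have h1 := h.pair hs w
  rw [Finset.sum_range_succ, h.last, h.monic, Finset.sum_eq_zero] at h1
  · simpa using h1.symm
  intro i hi
  rw [h.orth i (Finset.mem_range.mp hi), mul_zero]

theorem ND_of_orth {s : ℕ → R} (hs : ∀ j, star (s j) = s j)
    (h : ∀ k, ∃ w L, Orth s k w L ∧ IsUnit L) : ND s := by
  intro m
  induction m with
  | zero => intro u _ j hj; omega
  | succ m ih =>
    intro u hu
    obtain ⟨w, L, hw, hL⟩ := h m
    have h1 := hw.pair hs u
    rw [Finset.sum_eq_zero (fun i hi => by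
      rw [hu i (Finset.mem_range.mp hi), mul_zero])] at h1
    rw [hw.star_eq hs] at h1
    have h2 : u m = 0 := hL.mul_right_eq_zero.mp h1.symm
    have h3 := ih u (fun i hi => by
      have := hu i (by omega)
      rwa [hApp_succ, h2, mul_zero, add_zero] at this)
    intro j hj
    rcases Nat.lt_succ_iff_lt_or_eq.mp hj with h4 | h4
    · exact h3 j h4
    · rw [h4, h2]

theorem stepPhi {s w x x' b : ℕ → R} {k : ℕ} {L Li : R} (hs : ∀ j, star (s j) = s j)
    (hN : ND s) (hw : Orth s (k + 1) w L) (hL : Li * L = 1)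
    (hx : ∀ i < k + 2, hApp s (k + 2) x i = b i)
    (hx' : ∀ i < k + 1, hApp s (k + 1) x' i = b i) :
    ∑ i ∈ Finset.range (k + 2), star (b i) * x i -
        ∑ i ∈ Finset.range (k + 1), star (b i) * x' i =
      (∑ i ∈ Finset.range (k + 2), star (b i) * w i) * Li *
        star (∑ i ∈ Finset.range (k + 2), star (b i) * w i) := by
  have hc : x (k + 1) = Li * star (∑ i ∈ Finset.range (k + 2), star (b i) * w i) := by
    have h1 := hw.pair hs x
    rw [hw.star_eq hs] at h1
    have h2 : star (∑ i ∈ Finset.range (k + 2), star (b i) * w i) = L * x (k + 1) := by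
      rw [← h1, star_sum]
      refine Finset.sum_congr rfl fun i hi => ?_
      rw [hx i (Finset.mem_range.mp hi)]
      simp
    rw [h2, ← mul_assoc, hL, one_mul]
  have key := hN (k + 1) (fun j => x j - x' j - w j * x (k + 1)) (fun i hi => by
    rw [hApp_sub s (fun j => x j - x' j) (fun j => w j * x (k + 1)), hApp_sub s x x', hApp_mul,
      hx' i hi]
    have e1 := hx i (by omega)
    rw [hApp_succ] at e1
    have e2 := hw.orth i hi
    rw [hApp_succ, hw.monic] at e2
    rw [eq_neg_of_add_eq_zero_left e2, ← e1]
    simp)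
  rw [mul_assoc, ← hc, Finset.sum_range_succ, Finset.sum_range_succ _ (k + 1), hw.monic,
    add_mul, Finset.sum_mul, mul_one]
  rw [add_sub_right_comm, ← Finset.sum_sub_distrib]
  congr 1
  refine Finset.sum_congr rfl fun j hj => ?_
  have := sub_eq_zero.mp (key j (Finset.mem_range.mp hj))
  rw [← mul_sub, this, mul_assoc]

/-- Transformation of polynomials. -/
def TT (a : R) (s : ℕ → R) (m : ℕ) (u : ℕ → R) (i : ℕ) : R :=
  ∑ p ∈ Finset.range m, if i ≤ p then a * s (p - i) * u p else 0

theorem hApp_TT {a : R} {s t : ℕ → R} {F : ℕ → ℕ → R}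
    (hF : ∀ i j, ∑ l ∈ Finset.range (j + 1), t (i + l) * (a * s (j - l)) = F i j)
    (m : ℕ) (u : ℕ → R) (i : ℕ) :
    hApp t m (TT a s m u) i = ∑ p ∈ Finset.range m, F i p * u p := by
  unfold hApp TT
  simp only [Finset.mul_sum]
  rw [Finset.sum_comm]
  refine Finset.sum_congr rfl fun p hp => ?_
  have hp' := Finset.mem_range.mp hp
  rw [← hF, Finset.sum_mul]
  have : Finset.range (p + 1) ⊆ Finset.range m := Finset.range_subset_range.mpr hp'
  rw [← Finset.sum_subset this]
  · refine Finset.sum_congr rfl fun l hl => ?_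
    have := Finset.mem_range.mp hl
    rw [if_pos (by omega)]
    simp only [mul_assoc]
  · intro l _ hl
    rw [Finset.mem_range] at hl
    rw [if_neg (by omega), mul_zero]

theorem TT_last {a : R} {s : ℕ → R} (ha : a * s 0 = 1) (k : ℕ) (u : ℕ → R) :
    TT a s (k + 1) u k = u k := by
  unfold TT
  rw [Finset.sum_range_succ, Finset.sum_eq_zero]
  · simp [ha]
  · intro p hp
    have := Finset.mem_range.mp hp
    rw [if_neg (by omega)]

theorem tri {c : R} {r g : ℕ → R} {k : ℕ} {L : R} (hc : c * r 0 = 1) (hg : ∀ i < k, g i = 0)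
    (hk : g k = L) :
    (∀ i < k, ∑ l ∈ Finset.range (i + 1), c * r l * g (i - l) = 0) ∧
      ∑ l ∈ Finset.range (k + 1), c * r l * g (k - l) = L := by
  constructor
  · intro i hi
    refine Finset.sum_eq_zero fun l _ => ?_
    rw [hg _ (by omega), mul_zero]
  · rw [Finset.sum_range_succ', Finset.sum_eq_zero]
    · simp [hc, hk]
    · intro l hl
      have := Finset.mem_range.mp hl
      rw [hg _ (by omega), mul_zero]

/-- Conditions linking a sequence, its reciprocal and its transform. -/
structure Recip (s r t : ℕ → R) : Prop where
  left : ∀ n, ∑ l ∈ Finset.range (n + 1), r l * s (n - l) = if n = 0 then 1 else 0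
  right0 : s 0 * r 0 = 1
  t_eq : ∀ j, t j = -s 0 * r (j + 1) * s 0

theorem Recip.left0 {s r t : ℕ → R} (h : Recip s r t) : r 0 * s 0 = 1 := by
  simpa using h.left 0

theorem Recip.split {s r t : ℕ → R} (h : Recip s r t) (i j : ℕ) :
    ∑ l ∈ Finset.range (j + 1), r (i + 1 + l) * s (j - l) =
      -∑ l ∈ Finset.range (i + 1), r l * s (i - l + j + 1) := by
  have h1 := h.left (i + j + 1)
  rw [show i + j + 1 + 1 = (i + 1) + (j + 1) by omega, Finset.sum_range_add,
    if_neg (by omega)] at h1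
  rw [eq_neg_iff_add_eq_zero, add_comm, ← h1]
  congr 1
  · refine Finset.sum_congr rfl fun l hl => ?_
    have := Finset.mem_range.mp hl
    congr 2; omega
  · refine Finset.sum_congr rfl fun l hl => ?_
    have := Finset.mem_range.mp hl
    congr 2; omega

theorem Recip.keyA {s r t : ℕ → R} (h : Recip s r t) (i j : ℕ) :
    ∑ l ∈ Finset.range (j + 1), t (i + l) * (r 0 * s (j - l)) =
      ∑ l ∈ Finset.range (i + 1), s 0 * r l * s (i - l + j + 1) := by
  have h1 := h.split i j
  have h2 : ∀ l, t (i + l) * (r 0 * s (j - l)) = -(s 0 * (r (i + 1 + l) * s (j - l))) := by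
    intro l
    rw [h.t_eq, show i + l + 1 = i + 1 + l by omega]
    calc -s 0 * r (i + 1 + l) * s 0 * (r 0 * s (j - l))
        = -s 0 * r (i + 1 + l) * (s 0 * r 0) * s (j - l) := by simp only [mul_assoc]
      _ = _ := by rw [h.right0]; simp [mul_assoc]
  simp only [h2]
  rw [Finset.sum_neg_distrib, ← Finset.mul_sum, h1, mul_neg, neg_neg, Finset.mul_sum]
  simp only [mul_assoc]

theorem Recip.keyB {s r t : ℕ → R} (h : Recip s r t) (i j : ℕ) :
    ∑ l ∈ Finset.range (j + 1), sh t (i + l) * (r 0 * s (j - l)) =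
      ∑ l ∈ Finset.range (i + 1),
        s 0 * r l * (s (i - l + j + 2) - s (i - l + 1) * r 0 * s (j + 1)) := by
  have h1 := h.keyA (i + 1) j
  have h2 : ∀ l, sh t (i + l) = t (i + 1 + l) := by
    intro l; unfold sh; congr 1; omega
  simp only [h2]
  rw [h1, Finset.sum_range_succ]
  simp only [mul_sub, Finset.sum_sub_distrib]
  rw [sub_eq_add_neg]
  congr 1
  · refine Finset.sum_congr rfl fun l hl => ?_
    have := Finset.mem_range.mp hl
    congr 2; omega
  · have h3 := h.split i 0
    simp only [zero_add, Finset.sum_range_one, add_zero, Nat.sub_self] at h3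
    have h4 : ∀ l, s 0 * r l * (s (i - l + 1) * r 0 * s (j + 1)) =
        s 0 * (r l * s (i - l + 1)) * (r 0 * s (j + 1)) := fun l => by simp only [mul_assoc]
    simp only [h4]
    rw [← Finset.sum_mul, ← Finset.mul_sum, ← neg_mul, ← mul_neg, ← h3]
    rw [show s 0 * (r (i + 1) * s 0) * (r 0 * s (j + 1))
      = s 0 * r (i + 1) * (s 0 * r 0) * s (j + 1) by simp only [mul_assoc], h.right0]
    simp

theorem Recip.orthA {s r t w : ℕ → R} (h : Recip s r t) {k : ℕ} {L : R}
    (hw : Orth (sh s) k w L) : Orth t k (TT (r 0) s (k + 1) w) L := by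
  have e : ∀ i, hApp t (k + 1) (TT (r 0) s (k + 1) w) i =
      ∑ l ∈ Finset.range (i + 1), s 0 * r l * hApp (sh s) (k + 1) w (i - l) := by
    intro i
    rw [hApp_TT h.keyA]
    simp only [Finset.sum_mul, hApp, Finset.mul_sum]
    rw [Finset.sum_comm]
    simp only [sh, mul_assoc]
  obtain ⟨h1, h2⟩ := tri h.right0 hw.orth hw.last
  refine ⟨?_, ?_, ?_⟩
  · rw [TT_last h.left0, hw.monic]
  · intro i hi
    rw [e, h1 i hi]
  · rw [e, h2]

theorem Recip.orthB {s r t W : ℕ → R} (h : Recip s r t) {k : ℕ} {L : R}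
    (hW : Orth s (k + 1) W L) : Orth (sh t) k (TT (r 0) s (k + 1) (sh W)) L := by
  have e0 : ∀ i, ∑ p ∈ Finset.range (k + 1),
      (s (i + p + 2) - s (i + 1) * r 0 * s (p + 1)) * sh W p = hApp s (k + 2) W (i + 1) := by
    intro i
    have f0 := hW.orth 0 (Nat.succ_pos k)
    unfold hApp at f0 ⊢
    rw [Finset.sum_range_succ'] at f0
    rw [Finset.sum_range_succ' (fun j => s (i + 1 + j) * W j) (k + 1)]
    simp only [sub_mul, Finset.sum_sub_distrib]
    rw [sub_eq_add_neg]
    congr 1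
    · refine Finset.sum_congr rfl fun p _ => ?_
      unfold sh
      congr 2; omega
    · have : ∀ p, s (i + 1) * r 0 * s (p + 1) * sh W p =
          s (i + 1) * r 0 * (s (0 + (p + 1)) * W (p + 1)) := by
        intro p; simp only [mul_assoc, zero_add, sh]
      simp only [this]
      rw [← Finset.mul_sum, eq_neg_of_add_eq_zero_left f0, mul_neg, neg_neg, add_zero, add_zero]
      rw [mul_assoc (s (i + 1)), ← mul_assoc (r 0), h.left0, one_mul]
  have e : ∀ i, hApp (sh t) (k + 1) (TT (r 0) s (k + 1) (sh W)) i =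
      ∑ l ∈ Finset.range (i + 1), s 0 * r l * hApp s (k + 2) W (i - l + 1) := by
    intro i
    rw [hApp_TT h.keyB]
    simp only [Finset.sum_mul, ← e0, Finset.mul_sum]
    rw [Finset.sum_comm]
    simp only [mul_assoc]
  obtain ⟨h1, h2⟩ := tri (k := k) (g := fun i => hApp s (k + 2) W (i + 1)) h.right0
    (fun i hi => hW.orth (i + 1) (by omega)) hW.last
  refine ⟨?_, ?_, ?_⟩
  · rw [TT_last h.left0, sh, hW.monic]
  · intro i hi
    rw [e, h1 i hi]
  · rw [e, h2]

/-- `Q` is the Stieltjes parametrization of `s` (abstract characterisation). -/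
structure Par (s Q : ℕ → R) : Prop where
  herm : ∀ j, star (s j) = s j
  unit : ∀ j, IsUnit (Q j)
  even : ∀ k, ∃ w, Orth s k w (Q (2 * k))
  odd : ∀ k, ∃ w, Orth (sh s) k w (Q (2 * k + 1))

theorem Par.nd {s Q : ℕ → R} (h : Par s Q) : ND s :=
  ND_of_orth h.herm fun k => (h.even k).imp fun _ hw => ⟨_, hw, h.unit _⟩

theorem Par.nd' {s Q : ℕ → R} (h : Par s Q) : ND (sh s) :=
  ND_of_orth (fun _ => h.herm _) fun k => (h.odd k).imp fun _ hw => ⟨_, hw, h.unit _⟩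

theorem Par.step {s Q r t : ℕ → R} (h : Par s Q) (hr : Recip s r t) (hh : ∀ j, star (r j) = r j) :
    Par t (fun j => Q (j + 1)) := by
  refine ⟨?_, fun j => h.unit _, ?_, ?_⟩
  · intro j
    rw [hr.t_eq]
    simp [h.herm, hh, mul_assoc]
  · intro k
    obtain ⟨w, hw⟩ := h.odd k
    exact ⟨_, hr.orthA hw⟩
  · intro k
    obtain ⟨w, hw⟩ := h.even (k + 1)
    exact ⟨_, hr.orthB hw⟩

theorem Par.Q0 {s Q : ℕ → R} (h : Par s Q) : Q 0 = s 0 := by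
  obtain ⟨w, hw⟩ := h.even 0
  have := hw.last
  simpa [hApp, hw.monic] using this.symm

theorem Par.Q1 {s Q : ℕ → R} (h : Par s Q) : Q 1 = s 1 := by
  obtain ⟨w, hw⟩ := h.odd 0
  have := hw.last
  simpa [hApp, hw.monic, sh] using this.symm

theorem Par.starQ {s Q : ℕ → R} (h : Par s Q) (j : ℕ) : star (Q j) = Q j := by
  rcases Nat.even_or_odd' j with ⟨k, rfl | rfl⟩
  · obtain ⟨w, hw⟩ := h.even k
    exact hw.star_eq h.herm
  · obtain ⟨w, hw⟩ := h.odd k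
    exact hw.star_eq (fun _ => h.herm _)

theorem oprod_succ {α : Type*} [Monoid α] (f : ℕ → α) (n : ℕ) :
    oprod f (n + 1) = oprod f n * f (n + 1) := by
  simp [oprod, List.range_succ, mul_assoc]

theorem oprod_zero {α : Type*} [Monoid α] (f : ℕ → α) : oprod f 0 = f 0 := by
  simp [oprod]

theorem Par.valP {s Q Qi : ℕ → R} (h : Par s Q) (hi : ∀ j, Q j * Qi j = 1) (k : ℕ) (W : ℕ → R)
    (hW : Orth s (k + 1) W (Q (2 * (k + 1)))) :
    W 0 = oprod (fun j => Qi (2 * j) * Q (2 * j + 1)) k ∨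
      W 0 = -oprod (fun j => Qi (2 * j) * Q (2 * j + 1)) k := by
  induction k generalizing W with
  | zero =>
    obtain ⟨w, hw⟩ := h.even 0
    obtain ⟨w', hw'⟩ := h.odd 0
    right
    rw [stepP h.nd hw hw' hW (c := Qi 0 * Q 1) (by simp [← mul_assoc, hi]), hw.monic, oprod_zero]
    simp
  | succ k ih =>
    obtain ⟨w, hw⟩ := h.even (k + 1)
    obtain ⟨w', hw'⟩ := h.odd (k + 1)
    rw [stepP h.nd hw hw' hW (c := Qi (2 * (k + 1)) * Q (2 * (k + 1) + 1))
      (by rw [← mul_assoc, hi, one_mul]), oprod_succ]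
    rcases ih w hw with e | e
    · right; rw [e]
    · left; rw [e, neg_mul, neg_neg]

theorem Par.valQ {s Q Qi : ℕ → R} (h : Par s Q) (hi : ∀ j, Q j * Qi j = 1)
    (hi' : ∀ j, Qi j * Q j = 1) (k : ℕ) (W : ℕ → R)
    (hW : Orth (sh s) k W (Q (2 * k + 1))) :
    hApp s (k + 1) W 0 = oprod (fun j => Q (2 * j) * Qi (2 * j + 1)) k * Q (2 * k + 1) ∨
      hApp s (k + 1) W 0 = -(oprod (fun j => Q (2 * j) * Qi (2 * j + 1)) k * Q (2 * k + 1)) := by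
  induction k generalizing W with
  | zero =>
    left
    rw [oprod_zero, mul_assoc, hi', mul_one, mul_zero, h.Q0]
    simp [hApp, hW.monic]
  | succ k ih =>
    obtain ⟨w, hw⟩ := h.even (k + 1)
    obtain ⟨w', hw'⟩ := h.odd k
    rw [stepQ h.nd' hw' hw hW (d := Qi (2 * k + 1) * Q (2 * (k + 1)))
      (by rw [← mul_assoc, hi, one_mul]), oprod_succ]
    have e2 : oprod (fun j => Q (2 * j) * Qi (2 * j + 1)) k * Q (2 * k + 1) *
        (Qi (2 * k + 1) * Q (2 * (k + 1))) =
        oprod (fun j => Q (2 * j) * Qi (2 * j + 1)) k *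
          (Q (2 * (k + 1)) * Qi (2 * (k + 1) + 1)) * Q (2 * (k + 1) + 1) := by
      rw [mul_assoc, ← mul_assoc (Q (2 * k + 1)), hi, one_mul, mul_assoc, mul_assoc, hi', mul_one]
    rcases ih w' hw' with e | e
    · right; rw [e, e2]
    · left; rw [e, neg_mul, neg_neg, e2]

end AbstractPart

section MatrixPart
variable {q : ℕ}

/-- Block column with entries `u 0, …, u (m-1)`. -/
def colm (m : ℕ) (u : ℕ → Mq q) : Matrix (Fin m × Fin q) (Fin q) ℂ :=
  Matrix.of fun p b => u p.1.1 p.2 b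

theorem colm_inj {m : ℕ} {u v : ℕ → Mq q} (h : colm m u = colm m v) : ∀ i < m, u i = v i := by
  intro i hi
  ext a b
  exact congrFun (congrFun h (⟨i, hi⟩, a)) b

theorem colm_surj (m : ℕ) (X : Matrix (Fin m × Fin q) (Fin q) ℂ) : ∃ u, X = colm m u := by
  refine ⟨fun j => Matrix.of fun a b => if h : j < m then X (⟨j, h⟩, a) b else 0, ?_⟩
  ext p b
  simp [colm]

theorem colm_congr {m : ℕ} {u v : ℕ → Mq q} (h : ∀ i < m, u i = v i) : colm m u = colm m v := by
  ext p b
  simp [colm, h p.1.1 p.1.2]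

theorem Hmat_mul_colm (s u : ℕ → Mq q) (n : ℕ) :
    Hmat q s n * colm (n + 1) u = colm (n + 1) (hApp s (n + 1) u) := by
  ext p b
  simp only [Matrix.mul_apply, Fintype.sum_prod_type, Hmat, colm, Matrix.of_apply, hApp,
    Matrix.sum_apply]
  rw [Finset.sum_range (fun j => ∑ x, s (p.1.1 + j) p.2 x * u j x b)]

theorem colm_star_mul (m : ℕ) (u v : ℕ → Mq q) :
    (colm m u)ᴴ * colm m v = ∑ j ∈ Finset.range m, star (u j) * v j := by
  ext a b
  simp only [Matrix.mul_apply, Fintype.sum_prod_type, colm, Matrix.of_apply,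
    Matrix.sum_apply, Matrix.conjTranspose_apply, Matrix.star_apply]
  rw [Finset.sum_range (fun j => ∑ x, star (u j x a) * v j x b)]

theorem Kmat_eq (s : ℕ → Mq q) (n : ℕ) : Kmat q s n = Hmat q (sh s) n := rfl

theorem vcol_eq (k : ℕ) : vcol q k = colm (k + 1) (fun i => if i = 0 then 1 else 0) := by
  ext p b
  simp only [vcol, colm, Matrix.of_apply]
  by_cases h : p.1.1 = 0
  · simp only [h, true_and, if_true, Matrix.one_apply]
  · simp only [h, false_and, if_false, Matrix.zero_apply]

theorem ycol_eq (s : ℕ → Mq q) (k : ℕ) : ycol q s k = colm (k + 1) s := rfl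

theorem isUnit_of_cancel {L : Mq q} (h : ∀ c : Mq q, L * c = 0 → c = 0) : IsUnit L := by
  rw [Matrix.isUnit_iff_isUnit_det, isUnit_iff_ne_zero]
  intro hd
  obtain ⟨v, hv, hv0⟩ := Matrix.exists_mulVec_eq_zero_iff.mpr hd
  apply hv
  have := h (Matrix.of fun i _ => v i) (by
    ext i j
    exact congrFun hv0 i)
  ext i
  exact congrFun (congrFun this i) i

theorem ND.isUnit {s : ℕ → Mq q} (h : ND s) (n : ℕ) : IsUnit (Hmat q s n).det := by
  rw [isUnit_iff_ne_zero]
  intro hd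
  obtain ⟨v, hv, hv0⟩ := Matrix.exists_mulVec_eq_zero_iff.mpr hd
  apply hv
  obtain ⟨u, hu⟩ := colm_surj (n + 1) (Matrix.of fun i (_ : Fin q) => v i)
  have h1 : Hmat q s n * colm (n + 1) u = colm (n + 1) (fun _ => 0) := by
    rw [← hu]
    ext i j
    exact congrFun hv0 i
  rw [Hmat_mul_colm] at h1
  have h2 := h (n + 1) u (colm_inj h1)
  ext i
  have h3 : v i = colm (n + 1) u i i.2 := by rw [← hu]; rfl
  rw [h3]
  simp [colm, h2 i.1.1 i.1.2]

theorem ND_of_isUnit {s : ℕ → Mq q} (h : ∀ n, IsUnit (Hmat q s n).det) : ND s := by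
  intro m u hu
  cases m with
  | zero => intro j hj; omega
  | succ n =>
    have h1 : Hmat q s n * colm (n + 1) u = colm (n + 1) (fun _ => 0) := by
      rw [Hmat_mul_colm]
      exact colm_congr hu
    have h0 : colm (n + 1) (fun _ => (0 : Mq q)) = 0 := rfl
    have h2 : colm (n + 1) u = colm (n + 1) (fun _ => 0) := by
      rw [← Matrix.nonsing_inv_mul_cancel_left (A := Hmat q s n) (colm (n + 1) u) (h n), h1, h0,
        Matrix.mul_zero]
    exact colm_inj h2

/-- Solutions of Hankel systems. -/
theorem exists_sol {s : ℕ → Mq q} {n : ℕ} (h : IsUnit (Hmat q s n).det) (b : ℕ → Mq q) :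
    ∃ x, (Hmat q s n)⁻¹ * colm (n + 1) b = colm (n + 1) x ∧
      ∀ i < n + 1, hApp s (n + 1) x i = b i := by
  obtain ⟨x, hx⟩ := colm_surj (n + 1) ((Hmat q s n)⁻¹ * colm (n + 1) b)
  refine ⟨x, hx, colm_inj ?_⟩
  rw [← Hmat_mul_colm, ← hx, Matrix.mul_nonsing_inv_cancel_left _ _ h]

theorem phi_diff {s w b : ℕ → Mq q} {k : ℕ} {L : Mq q} (hs : ∀ j, star (s j) = s j)
    (hN : ND s) (hw : Orth s (k + 1) w L) (hL : IsUnit L) :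
    (colm (k + 2) b)ᴴ * (Hmat q s (k + 1))⁻¹ * colm (k + 2) b -
        (colm (k + 1) b)ᴴ * (Hmat q s k)⁻¹ * colm (k + 1) b =
      (∑ i ∈ Finset.range (k + 2), star (b i) * w i) * L⁻¹ *
        (∑ i ∈ Finset.range (k + 2), star (b i) * w i)ᴴ := by
  obtain ⟨x, hx, hx'⟩ := exists_sol (hN.isUnit (k + 1)) b
  obtain ⟨y, hy, hy'⟩ := exists_sol (hN.isUnit k) b
  rw [Matrix.mul_assoc, hx, Matrix.mul_assoc, hy, colm_star_mul, colm_star_mul]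
  exact stepPhi hs hN hw
    (Matrix.nonsing_inv_mul _ ((Matrix.isUnit_iff_isUnit_det _).mp hL)) hx' hy'

theorem orth_exists {s : ℕ → Mq q} (hs : ∀ j, star (s j) = s j) (hN : ND s) (k : ℕ) :
    ∃ w, Orth s k w (qEven q s k) := by
  cases k with
  | zero =>
    refine ⟨fun _ => 1, rfl, fun i hi => by omega, ?_⟩
    simp [hApp, qEven]
  | succ k =>
    obtain ⟨x, hx, hx'⟩ := exists_sol (hN.isUnit k) (fun i => s (k + 1 + i))
    have e : ∀ i, hApp s (k + 2) (fun j => if j < k + 1 then -x j else 1) i =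
        s (i + (k + 1)) - hApp s (k + 1) x i := by
      intro i
      rw [hApp_succ, if_neg (lt_irrefl _), mul_one, sub_eq_neg_add]
      congr 1
      unfold hApp
      rw [← Finset.sum_neg_distrib]
      refine Finset.sum_congr rfl fun j hj => ?_
      simp only [if_pos (Finset.mem_range.mp hj), mul_neg]
    refine ⟨fun j => if j < k + 1 then -x j else 1, if_neg (lt_irrefl _), ?_, ?_⟩
    · intro i hi
      rw [e, hx' i hi, add_comm, sub_self]
    · rw [e]
      have e1 : (Matrix.of fun (a : Fin q) (r : Fin (k + 1) × Fin q) => s (k + 1 + r.1.1) a r.2)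
          = (colm (k + 1) (fun i => s (k + 1 + i)))ᴴ := by
        ext a r
        simp only [colm, Matrix.conjTranspose_apply, Matrix.of_apply]
        conv_lhs => rw [← hs]
        rfl
      have e2 : (Matrix.of fun (p : Fin (k + 1) × Fin q) (b : Fin q) => s (k + 1 + p.1.1) p.2 b)
          = colm (k + 1) (fun i => s (k + 1 + i)) := rfl
      rw [qEven]
      rw [e1, e2, Matrix.mul_assoc, hx, colm_star_mul, two_mul]
      simp only [hs]
      rfl

theorem qOdd_eq_s2 (s : ℕ → Mq q) (k : ℕ) : qOdd q s k = qEven q (sh s) k := by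
  cases k with
  | zero => rfl
  | succ k =>
    rw [qOdd, qEven, Kmat_eq]
    have e : ∀ i, s (k + 2 + i) = sh s (k + 1 + i) := by
      intro i; unfold sh; congr 1; omega
    simp only [e]
    rfl

theorem par_init {s : ℕ → Mq q} (h : IsStieltjesPD q s) : Par s (qpar q s) := by
  have hs : ∀ j, star (s j) = s j := by
    intro j
    have h1 := (h j).1.1
    ext a b
    have h2 := congrFun (congrFun h1 (⟨j, by omega⟩, a)) (⟨0, by omega⟩, b)
    simpa [Hmat, Matrix.conjTranspose_apply] using h2
  have n1 : ND s := ND_of_isUnit fun n => (Matrix.isUnit_iff_isUnit_det _).mp (h n).1.isUnit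
  have n2 : ND (sh s) := ND_of_isUnit fun n => (Matrix.isUnit_iff_isUnit_det _).mp (h n).2.isUnit
  have q1 : ∀ k, qpar q s (2 * k) = qEven q s k := by
    intro k; simp [qpar]
  have q2 : ∀ k, qpar q s (2 * k + 1) = qEven q (sh s) k := by
    intro k
    rw [← qOdd_eq_s2]
    unfold qpar
    rw [if_neg (by omega)]
    congr 1; omega
  have o1 := orth_exists hs n1
  have o2 := orth_exists (s := sh s) (fun _ => hs _) n2
  refine ⟨hs, ?_, ?_, ?_⟩
  · intro j
    rcases Nat.even_or_odd' j with ⟨k, rfl | rfl⟩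
    · rw [q1]
      obtain ⟨w, hw⟩ := o1 k
      exact isUnit_of_cancel (hw.unit_cancel n1)
    · rw [q2]
      obtain ⟨w, hw⟩ := o2 k
      exact isUnit_of_cancel (hw.unit_cancel n2)
  · intro k; rw [q1]; exact o1 k
  · intro k; rw [q2]; exact o2 k

theorem reciprocal_conv {s : ℕ → Mq q} (h0 : IsUnit (s 0)) (n : ℕ) :
    ∑ l ∈ Finset.range (n + 1), s (n - l) * reciprocal q s l = if n = 0 then 1 else 0 := by
  have hd := (Matrix.isUnit_iff_isUnit_det _).mp h0
  cases n with
  | zero =>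
    simp [reciprocal, Matrix.mul_nonsing_inv _ hd]
  | succ n =>
    rw [Finset.sum_range_succ, if_neg (Nat.succ_ne_zero n), Nat.sub_self]
    conv_lhs => rw [reciprocal.eq_2]
    rw [Finset.sum_attach (Finset.range (n + 1))
      (fun l => s (n + 1 - l) * reciprocal q s l)]
    rw [← mul_assoc, mul_neg, Matrix.mul_nonsing_inv _ hd]
    simp

theorem reciprocal_props {s : ℕ → Mq q} (hs : ∀ j, star (s j) = s j) (h0 : IsUnit (s 0)) :
    Recip s (reciprocal q s) (katetov1 q s) ∧
      ∀ j, star (reciprocal q s j) = reciprocal q s j := by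
  set r := reciprocal q s with hr
  have c1 := reciprocal_conv h0
  have c2 : ∀ n, ∑ l ∈ Finset.range (n + 1), star (r l) * s (n - l) = if n = 0 then 1 else 0 := by
    intro n
    have := congrArg star (c1 n)
    rw [star_sum] at this
    simp only [star_mul, hs] at this
    rw [this]
    split_ifs <;> simp
  have p1 : PowerSeries.mk s * PowerSeries.mk r = 1 := by
    ext1 n
    rw [PowerSeries.coeff_mul, PowerSeries.coeff_one, ← c1 n,
      ← Finset.Nat.sum_antidiagonal_swap,
      Finset.Nat.sum_antidiagonal_eq_sum_range_succ_mk]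
    simp [hr]
  have p2 : PowerSeries.mk (fun l => star (r l)) * PowerSeries.mk s = 1 := by
    ext1 n
    rw [PowerSeries.coeff_mul, PowerSeries.coeff_one, ← c2 n,
      Finset.Nat.sum_antidiagonal_eq_sum_range_succ_mk]
    simp
  have p3 := left_inv_eq_right_inv p2 p1
  have p4 : ∀ j, star (r j) = r j := by
    intro j
    have := congrArg (PowerSeries.coeff j) p3
    simpa using this
  refine ⟨⟨?_, ?_, fun j => rfl⟩, p4⟩
  · intro n
    rw [← c2 n]
    simp only [p4]
  · simpa using c1 0

theorem par_katetov {s : ℕ → Mq q} (h : IsStieltjesPD q s) (ℓ : ℕ) :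
    Par (katetov q ℓ s) (fun j => qpar q s (j + ℓ)) := by
  induction ℓ with
  | zero => exact par_init h
  | succ ℓ ih =>
    have h0 : IsUnit (katetov q ℓ s 0) := by
      rw [← ih.Q0]; exact ih.unit 0
    obtain ⟨h1, h2⟩ := reciprocal_props ih.herm h0
    have h3 := ih.step h1 h2
    have e : katetov q (ℓ + 1) s = katetov1 q (katetov q ℓ s) := by
      unfold katetov
      rw [Function.iterate_succ_apply']
    rw [e]
    have e2 : (fun j => qpar q s (j + (ℓ + 1))) = fun j => qpar q s (j + 1 + ℓ) := by
      ext1 j; congr 1; omega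
    rw [e2]
    exact h3

theorem par_DSM {s Q : ℕ → Mq q} (h : Par s Q) (k : ℕ) :
    DSM q s (k + 1) =
      oprod (fun j => (Q (2 * j))⁻¹ * Q (2 * j + 1)) k * (Q (2 * (k + 1)))⁻¹ *
        (oprod (fun j => (Q (2 * j))⁻¹ * Q (2 * j + 1)) k)ᴴ := by
  have hd := fun j => (Matrix.isUnit_iff_isUnit_det _).mp (h.unit j)
  obtain ⟨w, hw⟩ := h.even (k + 1)
  rw [DSM]
  rw [vcol_eq, vcol_eq, phi_diff h.herm h.nd hw (h.unit _)]
  have e : ∑ i ∈ Finset.range (k + 2), star (if i = 0 then (1 : Mq q) else 0) * w i = w 0 := by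
    rw [Finset.sum_range_succ']
    simp
  rw [e]
  rcases h.valP (Qi := fun j => (Q j)⁻¹) (fun j => Matrix.mul_nonsing_inv _ (hd j)) k w hw with e | e
  · rw [e]
  · rw [e, Matrix.conjTranspose_neg]; simp

theorem par_DSL {s Q : ℕ → Mq q} (h : Par s Q) (k : ℕ) :
    DSL q s k =
      oprod (fun j => Q (2 * j) * (Q (2 * j + 1))⁻¹) k * Q (2 * k + 1) *
        (oprod (fun j => Q (2 * j) * (Q (2 * j + 1))⁻¹) k)ᴴ := by
  have hd := fun j => (Matrix.isUnit_iff_isUnit_det _).mp (h.unit j)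
  have hst : ∀ j, (Q j)ᴴ = Q j := h.starQ
  cases k with
  | zero =>
    rw [oprod_zero, Matrix.conjTranspose_mul, Matrix.conjTranspose_nonsing_inv, hst, hst]
    simp only [mul_zero, zero_add]
    rw [Matrix.nonsing_inv_mul_cancel_right _ _ (hd 1), h.Q0, h.Q1, ← mul_assoc]
    rfl
  | succ k =>
    obtain ⟨w, hw⟩ := h.odd (k + 1)
    rw [DSL]
    rw [ycol_eq, ycol_eq, Kmat_eq, Kmat_eq, phi_diff (s := sh s) (fun _ => h.herm _) h.nd' hw (h.unit _)]
    have e : ∑ i ∈ Finset.range (k + 2), star (s i) * w i = hApp s (k + 2) w 0 := by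
      simp [hApp, h.herm]
    rw [e]
    have e3 : ∀ X : Mq q, X * Q (2 * (k + 1) + 1) * (Q (2 * (k + 1) + 1))⁻¹ *
        (X * Q (2 * (k + 1) + 1))ᴴ = X * Q (2 * (k + 1) + 1) * Xᴴ := by
      intro X
      rw [Matrix.mul_nonsing_inv_cancel_right _ _ (hd _), Matrix.conjTranspose_mul, hst, mul_assoc]
    rcases h.valQ (Qi := fun j => (Q j)⁻¹) (fun j => Matrix.mul_nonsing_inv _ (hd j))
      (fun j => Matrix.nonsing_inv_mul _ (hd j)) (k + 1) w hw with e | e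
    · rw [e, e3]
    · rw [e, Matrix.conjTranspose_neg, neg_mul, neg_mul_neg, e3]

end MatrixPart

/-- Dyukarev–Stieltjes parameters of the `ℓ`-th Kátětov transform in terms of the
Stieltjes parametrization of the original sequence. -/
theorem stmt2 (q : ℕ) (hq : 1 ≤ q) (s : ℕ → Mq q) (hs : IsStieltjesPD q s) (ℓ k : ℕ) :
    DSL q (katetov q ℓ s) k =
        oprod (fun j => qpar q s (2 * j + ℓ) * (qpar q s (2 * j + ℓ + 1))⁻¹) k *
          qpar q s (2 * k + ℓ + 1) *
          (oprod (fun j => qpar q s (2 * j + ℓ) * (qpar q s (2 * j + ℓ + 1))⁻¹) k)ᴴ ∧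
      DSM q (katetov q ℓ s) 0 = (qpar q s ℓ)⁻¹ ∧
      (1 ≤ k →
        DSM q (katetov q ℓ s) k =
          oprod (fun j => (qpar q s (2 * j + ℓ))⁻¹ * qpar q s (2 * j + ℓ + 1)) (k - 1) *
            (qpar q s (2 * k + ℓ))⁻¹ *
            (oprod (fun j => (qpar q s (2 * j + ℓ))⁻¹ * qpar q s (2 * j + ℓ + 1)) (k - 1))ᴴ) := by
  have h := par_katetov hs ℓ
  refine ⟨?_, ?_, ?_⟩
  · have h1 := par_DSL h k
    simp only [show ∀ j, 2 * j + 1 + ℓ = 2 * j + ℓ + 1 from fun j => by omega] at h1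
    exact h1
  · have h1 := h.Q0
    simp only [zero_add] at h1
    rw [h1]
    rfl
  · intro hk
    obtain ⟨k, rfl⟩ : ∃ k', k = k' + 1 := ⟨k - 1, by omega⟩
    have h1 := par_DSM h k
    simp only [show ∀ j, 2 * j + 1 + ℓ = 2 * j + ℓ + 1 from fun j => by omega] at h1
    exact h1

end
end

section
/- Let q ≥ 1 be an integer and let (s_j)_{j=0}^∞ be a Stieltjes positive definite sequence of complex q×q matrices with Stieltjes parametrization (𝔮_j)_{j=0}^∞. Then for all ℓ ∈ ℕ₀ and k ∈ ℕ₀, the Dyukarev–Stieltjes parameters of the Kátětov transforms satisfy 𝔏_k^{(ℓ+1)} = 𝔮_ℓ · 𝔐_{k+1}^{(ℓ)} · 𝔮_ℓ and 𝔐_k^{(ℓ+1)} = 𝔮_ℓ^{−1} · 𝔏_k^{(ℓ)} · 𝔮_ℓ^{−1}. -/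
open Matrix
open scoped ComplexOrder

noncomputable section

section Abstract

variable {A : Type*} [Ring A]

/-- Abstract block Hankel matrix. -/
def aHk (f : ℕ → A) (n : ℕ) : Matrix (Fin (n + 1)) (Fin (n + 1)) A :=
  Matrix.of fun i j => f (i.1 + j.1)

/-- Lower triangular block Toeplitz matrix. -/
def aTl (f : ℕ → A) (n : ℕ) : Matrix (Fin (n + 1)) (Fin (n + 1)) A :=
  Matrix.of fun i j => if j.1 ≤ i.1 then f (i.1 - j.1) else 0

/-- Upper triangular block Toeplitz matrix. -/
def aTu (f : ℕ → A) (n : ℕ) : Matrix (Fin (n + 1)) (Fin (n + 1)) A :=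
  Matrix.of fun i j => if i.1 ≤ j.1 then f (j.1 - i.1) else 0

/-- The block diagonal matrix `diag(a, B)`. -/
def aDg (a : A) {n : ℕ} (B : Matrix (Fin n) (Fin n) A) :
    Matrix (Fin (n + 1)) (Fin (n + 1)) A :=
  Matrix.of fun i j => Fin.cases (Fin.cases a (fun _ => 0) j)
    (fun ii => Fin.cases 0 (fun jj => B ii jj) j) i

/-- Convolution inverse relation. -/
def aConv (s r : ℕ → A) : Prop :=
  ∀ n, ∑ a ∈ Finset.range (n + 1), s a * r (n - a) = if n = 0 then 1 else 0

lemma sum_fin_le (n j : ℕ) (hj : j < n + 1) (f : ℕ → A) :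
    ∑ a : Fin (n + 1), (if a.1 ≤ j then f a.1 else 0) = ∑ a ∈ Finset.range (j + 1), f a := by
  rw [Fin.sum_univ_eq_sum_range (fun a => if a ≤ j then f a else 0), ← Finset.sum_filter]
  congr 1
  ext a
  simp only [Finset.mem_filter, Finset.mem_range]
  omega

lemma sum_fin_Icc (n i j : ℕ) (hij : i ≤ j) (hj : j < n + 1) (f : ℕ → A) :
    ∑ a : Fin (n + 1), (if i ≤ a.1 ∧ a.1 ≤ j then f a.1 else 0)
      = ∑ a ∈ Finset.range (j - i + 1), f (i + a) := by
  rw [Fin.sum_univ_eq_sum_range (fun a => if i ≤ a ∧ a ≤ j then f a else 0), ← Finset.sum_filter]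
  symm
  apply Finset.sum_bij (fun a _ => i + a)
  · intro a ha
    simp only [Finset.mem_filter, Finset.mem_range] at *
    omega
  · intro a _ b _ h
    omega
  · intro b hb
    simp only [Finset.mem_filter, Finset.mem_range] at hb
    exact ⟨b - i, by simp only [Finset.mem_range]; omega, by omega⟩
  · intro a _
    rfl

lemma aTu_mul (s r : ℕ → A) (h : aConv s r) (n : ℕ) : aTu s n * aTu r n = 1 := by
  ext i j
  rw [Matrix.mul_apply]
  have e : ∀ a : Fin (n + 1), aTu s n i a * aTu r n a j
      = if i.1 ≤ a.1 ∧ a.1 ≤ j.1 then s (a.1 - i.1) * r (j.1 - a.1) else 0 := by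
    intro a
    simp only [aTu, Matrix.of_apply]
    split_ifs <;> first | rfl | (exfalso; omega) | simp
  rw [Finset.sum_congr rfl fun a _ => e a]
  by_cases hij : i.1 ≤ j.1
  · rw [sum_fin_Icc n i.1 j.1 hij j.2 (fun a => s (a - i.1) * r (j.1 - a))]
    have := h (j.1 - i.1)
    rw [Matrix.one_apply]
    convert this using 2
    · rename_i a _
      simp only [Nat.add_sub_cancel_left, Nat.sub_sub]
    · rw [Fin.ext_iff]
      omega
  · rw [Finset.sum_eq_zero, Matrix.one_apply_ne]
    · rw [Ne, Fin.ext_iff]; omega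
    · intro a _
      rw [if_neg]; omega

lemma aTl_mul (s r : ℕ → A) (h : aConv s r) (n : ℕ) : aTl s n * aTl r n = 1 := by
  ext i j
  rw [Matrix.mul_apply]
  have e : ∀ a : Fin (n + 1), aTl s n i a * aTl r n a j
      = if j.1 ≤ a.1 ∧ a.1 ≤ i.1 then s (i.1 - a.1) * r (a.1 - j.1) else 0 := by
    intro a
    simp only [aTl, Matrix.of_apply]
    split_ifs <;> first | rfl | (exfalso; omega) | simp
  rw [Finset.sum_congr rfl fun a _ => e a]
  by_cases hij : j.1 ≤ i.1
  · rw [sum_fin_Icc n j.1 i.1 hij i.2 (fun a => s (i.1 - a) * r (a - j.1))]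
    have := h (i.1 - j.1)
    rw [Matrix.one_apply, ← Finset.sum_range_reflect]
    convert this using 2
    · rename_i a ha
      rw [Finset.mem_range] at ha
      congr 2 <;> omega
    · rw [Fin.ext_iff]
      omega
  · rw [Finset.sum_eq_zero, Matrix.one_apply_ne]
    · rw [Ne, Fin.ext_iff]; omega
    · intro a _
      rw [if_neg]; omega

lemma conv_split (r s : ℕ → A) (h : aConv r s) (j k : ℕ) :
    ∑ a ∈ Finset.range (j + 1), r (j - a) * s (a + k + 1)
      + ∑ i ∈ Finset.range (k + 1), r (j + i + 1) * s (k - i) = 0 := by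
  have := h (j + k + 1)
  rw [if_neg (by omega), show j + k + 1 + 1 = (j + 1) + (k + 1) by ring,
    Finset.sum_range_add] at this
  rw [← this, ← Finset.sum_range_reflect]
  congr 1
  · apply Finset.sum_congr rfl
    intro a ha
    rw [Finset.mem_range] at ha
    congr 2 <;> omega
  · apply Finset.sum_congr rfl
    intro a ha
    rw [Finset.mem_range] at ha
    congr 2 <;> omega

lemma aTl_aHk1 (r s : ℕ → A) (h : aConv r s) (n : ℕ) :
    aTl r n * aHk (fun j => s (j + 1)) n = - aHk (fun j => r (j + 1)) n * aTu s n := by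
  rw [neg_mul, eq_neg_iff_add_eq_zero]
  ext j k
  rw [Matrix.add_apply, Matrix.mul_apply, Matrix.mul_apply, Matrix.zero_apply,
    ← conv_split r s h j.1 k.1,
    ← sum_fin_le n j.1 j.2 (fun a => r (j.1 - a) * s (a + k.1 + 1)),
    ← sum_fin_le n k.1 k.2 (fun i => r (j.1 + i + 1) * s (k.1 - i))]
  simp only [aTl, aTu, aHk, Matrix.of_apply, ite_mul, mul_ite, zero_mul, mul_zero]

lemma aTl_aHk (r s : ℕ → A) (h : aConv r s) (n : ℕ) :
    aTl r (n + 1) * aHk s (n + 1)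
      = aDg (r 0) (- aHk (fun j => r (j + 2)) n) * aTu s (n + 1) := by
  ext j k
  rw [Matrix.mul_apply, Matrix.mul_apply]
  refine Fin.cases ?_ (fun j => ?_) j
  · rw [Finset.sum_eq_single 0, Finset.sum_eq_single 0]
    · simp [aTl, aTu, aHk, aDg]
    · intro x _ hx
      obtain ⟨y, rfl⟩ := Fin.exists_succ_eq.2 hx
      simp [aDg]
    · simp
    · intro x _ hx
      obtain ⟨y, rfl⟩ := Fin.exists_succ_eq.2 hx
      simp [aTl]
    · simp
  · rw [Fin.sum_univ_succ (f := fun x => aDg (r 0) (- aHk (fun j => r (j + 2)) n) j.succ x * _)]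
    have h1 : ∑ a, aTl r (n + 1) j.succ a * aHk s (n + 1) a k
        = ∑ a ∈ Finset.range (j.1 + 1 + 1), r (j.1 + 1 - a) * s (a + k.1) := by
      rw [← sum_fin_le (n + 1) (j.1 + 1) (by omega) (fun a => r (j.1 + 1 - a) * s (a + k.1))]
      simp only [aTl, aHk, Matrix.of_apply, ite_mul, zero_mul, Fin.val_succ]
    rw [h1]
    refine Fin.cases ?_ (fun k => ?_) k
    · simp only [aDg, Matrix.of_apply, Fin.cases_succ, Fin.cases_zero, zero_mul, zero_add, aTu]
      rw [Finset.sum_eq_zero (s := (Finset.univ : Finset (Fin (n + 1)))) (fun x _ => by simp)]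
      have := h (j.1 + 1)
      rw [← Finset.sum_range_reflect] at this
      rw [if_neg (by omega)] at this
      rw [← this]
      apply Finset.sum_congr rfl
      intro a ha
      rw [Finset.mem_range] at ha
      congr 2
      rw [Fin.val_zero]; omega
    · simp only [aDg, Matrix.of_apply, Fin.cases_succ, Fin.cases_zero, zero_mul, zero_add,
        Matrix.neg_apply, neg_mul, Finset.sum_neg_distrib]
      rw [eq_neg_iff_add_eq_zero, ← conv_split r s h (j.1 + 1) k.1]
      congr 1
      rw [← sum_fin_le n k.1 k.2 (fun i => r (j.1 + 1 + i + 1) * s (k.1 - i))]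
      apply Finset.sum_congr rfl
      intro x _
      simp only [aHk, aTu, Matrix.of_apply, Fin.val_succ, mul_ite, mul_zero]
      rw [show j.1 + 1 + x.1 + 1 = j.1 + x.1 + 2 by ring]
      simp

lemma aDg_mul (a b : A) {n : ℕ} (B C : Matrix (Fin n) (Fin n) A) :
    aDg a B * aDg b C = aDg (a * b) (B * C) := by
  ext i j
  rw [Matrix.mul_apply, Fin.sum_univ_succ]
  refine Fin.cases ?_ (fun i => ?_) i <;> refine Fin.cases ?_ (fun j => ?_) j <;>
    simp [aDg, Matrix.mul_apply]

lemma aDg_one {n : ℕ} : aDg (1 : A) (1 : Matrix (Fin n) (Fin n) A) = 1 := by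
  ext i j
  refine Fin.cases ?_ (fun i => ?_) i <;> refine Fin.cases ?_ (fun j => ?_) j <;>
    simp [aDg, Matrix.one_apply, (Fin.succ_ne_zero _).symm]

/-- Scalar block diagonal matrix. -/
abbrev aSc (a : A) (n : ℕ) : Matrix (Fin (n + 1)) (Fin (n + 1)) A := Matrix.diagonal fun _ => a

/-- Abstract transform. -/
def aT (s r : ℕ → A) : ℕ → A := fun j => - s 0 * r (j + 1) * s 0

lemma aHk_aT (s r : ℕ → A) (hrs : aConv r s) (hsr : aConv s r) (n : ℕ) :
    aHk (aT s r) n = aSc (s 0) n * aTl r n * aHk (fun j => s (j + 1)) n * (aTu r n * aSc (s 0) n) := by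
  rw [mul_assoc (aSc (s 0) n), aTl_aHk1 r s hrs, neg_mul, mul_neg, ← mul_assoc, neg_mul, ← mul_assoc,
    mul_assoc _ (aTu s n), aTu_mul s r hsr, mul_one]
  ext i j
  simp [aHk, aT, Matrix.diagonal_mul, Matrix.mul_diagonal]

lemma aDg_eq (s r : ℕ → A) (hrs : aConv r s) (hsr : aConv s r) (n : ℕ) :
    aDg (r 0) (- aHk (fun j => r (j + 2)) n) = aTl r (n + 1) * aHk s (n + 1) * aTu r (n + 1) := by
  rw [aTl_aHk r s hrs, mul_assoc, aTu_mul s r hsr, mul_one]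

lemma aHk_aT1 (s r : ℕ → A) (n : ℕ) :
    aHk (fun j => aT s r (j + 1)) n
      = aSc (s 0) n * (- aHk (fun j => r (j + 2)) n) * aSc (s 0) n := by
  ext i j
  simp [aHk, aT, Matrix.diagonal_mul, Matrix.mul_diagonal]

lemma conv_zero (s r : ℕ → A) (h : aConv s r) : s 0 * r 0 = 1 := by
  simpa using h 0

/-- Inverse of the Hankel matrix of the transform. -/
lemma aInv_one (s r : ℕ → A) (hrs : aConv r s) (hsr : aConv s r) (n : ℕ)
    (G Gt : Matrix (Fin (n + 1)) (Fin (n + 1)) A)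
    (hG : aHk (fun j => s (j + 1)) n * G = 1)
    (hGt : Gt * aHk (aT s r) n = 1) :
    Gt = aSc (r 0) n * aTu s n * G * (aTl s n * aSc (r 0) n) := by
  have h0 := conv_zero s r hsr
  have h0' := conv_zero r s hrs
  apply left_inv_eq_right_inv hGt
  have e1 : aSc (s 0) n * aSc (r 0) n = 1 := by
    rw [Matrix.diagonal_mul_diagonal, h0, Matrix.diagonal_one]
  rw [aHk_aT s r hrs hsr]
  calc _ = aSc (s 0) n * (aTl r n * (aHk (fun j => s (j + 1)) n * ((aTu r n *
        ((aSc (s 0) n * aSc (r 0) n) * aTu s n)) * G) * aTl s n)) * aSc (r 0) n := by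
        simp only [mul_assoc]
    _ = 1 := by
      rw [e1, one_mul, aTu_mul r s hrs, one_mul, hG, one_mul, aTl_mul r s hrs, mul_one, e1]

lemma aInv_two (s r : ℕ → A) (hrs : aConv r s) (hsr : aConv s r) (n : ℕ)
    (G : Matrix (Fin (n + 2)) (Fin (n + 2)) A) (Gt : Matrix (Fin (n + 1)) (Fin (n + 1)) A)
    (hG : G * aHk s (n + 1) = 1)
    (hGt : aHk (fun j => aT s r (j + 1)) n * Gt = 1) :
    G = aTu r (n + 1) * aDg (s 0) (aSc (s 0) n * Gt * aSc (s 0) n) * aTl r (n + 1) := by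
  have h0 := conv_zero s r hsr
  have h0' := conv_zero r s hrs
  have e1 : aSc (s 0) n * aSc (r 0) n = 1 := by
    rw [Matrix.diagonal_mul_diagonal, h0, Matrix.diagonal_one]
  have e2 : aSc (r 0) n * aSc (s 0) n = 1 := by
    rw [Matrix.diagonal_mul_diagonal, h0', Matrix.diagonal_one]
  apply left_inv_eq_right_inv hG
  have e3 : (- aHk (fun j => r (j + 2)) n) * (aSc (s 0) n * Gt * aSc (s 0) n) = 1 := by
    rw [aHk_aT1] at hGt
    calc _ = (aSc (r 0) n * aSc (s 0) n) * (- aHk (fun j => r (j + 2)) n) *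
          (aSc (s 0) n * Gt * aSc (s 0) n) := by rw [e2, one_mul]
      _ = aSc (r 0) n * (aSc (s 0) n * (- aHk (fun j => r (j + 2)) n) *
          aSc (s 0) n * Gt) * aSc (s 0) n := by simp only [mul_assoc]
      _ = 1 := by rw [hGt, mul_one, e2]
  have e4 : aHk s (n + 1) * aTu r (n + 1)
      = aTl s (n + 1) * aDg (r 0) (- aHk (fun j => r (j + 2)) n) := by
    rw [aDg_eq s r hrs hsr, ← mul_assoc, ← mul_assoc, aTl_mul s r hsr, one_mul]
  rw [← mul_assoc, ← mul_assoc, e4, mul_assoc (aTl s (n + 1)), aDg_mul, h0', e3, aDg_one, mul_one,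
    aTl_mul s r hsr]

lemma M_trans (s r : ℕ → A) (hrs : aConv r s) (hsr : aConv s r) (n : ℕ)
    (G Gt : Matrix (Fin (n + 1)) (Fin (n + 1)) A)
    (hG : aHk (fun j => s (j + 1)) n * G = 1)
    (hGt : Gt * aHk (aT s r) n = 1) :
    Gt 0 0 = r 0 * (∑ i, ∑ j, s i.1 * G i j * s j.1) * r 0 := by
  rw [aInv_one s r hrs hsr n G Gt hG hGt]
  rw [← mul_assoc, Matrix.mul_diagonal, mul_assoc, mul_assoc, Matrix.diagonal_mul]
  congr 2
  rw [← mul_assoc, Matrix.mul_apply, Finset.sum_comm]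
  apply Finset.sum_congr rfl
  intro j _
  rw [Matrix.mul_apply, Finset.sum_mul]
  apply Finset.sum_congr rfl
  intro i _
  simp [aTu, aTl]

lemma q_trans_one (s r : ℕ → A) (hrs : aConv r s) (hsr : aConv s r) (n : ℕ)
    (G Gt : Matrix (Fin (n + 1)) (Fin (n + 1)) A)
    (hG : aHk (fun j => s (j + 1)) n * G = 1)
    (hGt : Gt * aHk (aT s r) n = 1) :
    Gt (Fin.last n) (Fin.last n) = G (Fin.last n) (Fin.last n) := by
  have h0 := conv_zero s r hsr
  have h0' := conv_zero r s hrs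
  rw [aInv_one s r hrs hsr n G Gt hG hGt]
  rw [← mul_assoc, Matrix.mul_diagonal, mul_assoc, mul_assoc, Matrix.diagonal_mul]
  rw [← mul_assoc, Matrix.mul_apply, Finset.sum_eq_single (Fin.last n)]
  · rw [Matrix.mul_apply, Finset.sum_eq_single (Fin.last n)]
    · simp only [aTu, aTl, Matrix.of_apply, le_refl, if_true, Nat.sub_self]
      rw [← mul_assoc, ← mul_assoc, h0', one_mul, mul_assoc, h0, mul_one]
    · intro b _ hb
      rw [Ne, Fin.ext_iff, Fin.val_last] at hb
      simp only [aTu, Matrix.of_apply, Fin.val_last]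
      rw [if_neg (by omega), zero_mul]
    · simp
  · intro b _ hb
    rw [Ne, Fin.ext_iff, Fin.val_last] at hb
    simp only [aTl, Matrix.of_apply, Fin.val_last]
    rw [if_neg (by omega), mul_zero]
  · simp

lemma L_trans (s r : ℕ → A) (hrs : aConv r s) (hsr : aConv s r) (n : ℕ)
    (G : Matrix (Fin (n + 2)) (Fin (n + 2)) A) (Gt : Matrix (Fin (n + 1)) (Fin (n + 1)) A)
    (hG : G * aHk s (n + 1) = 1)
    (hGt : aHk (fun j => aT s r (j + 1)) n * Gt = 1) :
    ∑ i, ∑ j, aT s r i.1 * Gt i j * aT s r j.1 = s 0 * (G 0 0 - r 0) * s 0 := by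
  have h0 := conv_zero s r hsr
  have h0' := conv_zero r s hrs
  have key : G 0 0 = r 0 + ∑ i : Fin (n + 1), ∑ j : Fin (n + 1),
      r (i.1 + 1) * (s 0 * Gt i j * s 0) * r (j.1 + 1) := by
    rw [aInv_two s r hrs hsr n G Gt hG hGt, Matrix.mul_apply, Fin.sum_univ_succ, Matrix.mul_apply,
      Fin.sum_univ_succ, Finset.sum_eq_zero]
    · congr 1
      · simp [aTu, aTl, aDg, mul_assoc, h0]
      · rw [Finset.sum_comm]
        apply Finset.sum_congr rfl
        intro j _
        rw [Matrix.mul_apply, Fin.sum_univ_succ, add_mul, Finset.sum_mul]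
        simp [aTu, aTl, aDg, Matrix.diagonal_mul, Matrix.mul_diagonal]
    · intro x _
      simp [aDg]
  rw [key, add_sub_cancel_left, Finset.mul_sum, Finset.sum_mul]
  apply Finset.sum_congr rfl
  intro i _
  rw [Finset.mul_sum, Finset.sum_mul]
  apply Finset.sum_congr rfl
  intro j _
  simp only [aT, neg_mul, mul_neg, neg_neg, mul_assoc]

lemma q_trans_two (s r : ℕ → A) (hrs : aConv r s) (hsr : aConv s r) (n : ℕ)
    (G : Matrix (Fin (n + 2)) (Fin (n + 2)) A) (Gt : Matrix (Fin (n + 1)) (Fin (n + 1)) A)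
    (hG : G * aHk s (n + 1) = 1)
    (hGt : aHk (fun j => aT s r (j + 1)) n * Gt = 1) :
    G (Fin.last (n + 1)) (Fin.last (n + 1)) = Gt (Fin.last n) (Fin.last n) := by
  have h0 := conv_zero s r hsr
  have h0' := conv_zero r s hrs
  rw [aInv_two s r hrs hsr n G Gt hG hGt]
  rw [Matrix.mul_apply, Finset.sum_eq_single (Fin.last (n + 1))]
  · rw [Matrix.mul_apply, Finset.sum_eq_single (Fin.last (n + 1))]
    · simp only [aTu, aTl, Matrix.of_apply, le_refl, if_true, Nat.sub_self]
      rw [← Fin.succ_last]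
      simp only [aDg, Matrix.of_apply, Fin.cases_succ, Matrix.diagonal_mul, Matrix.mul_diagonal]
      rw [← mul_assoc, ← mul_assoc, h0', one_mul, mul_assoc, h0, mul_one]
    · intro b _ hb
      rw [Ne, Fin.ext_iff, Fin.val_last] at hb
      simp only [aTu, Matrix.of_apply, Fin.val_last]
      rw [if_neg (by omega), zero_mul]
    · simp
  · intro b _ hb
    rw [Ne, Fin.ext_iff, Fin.val_last] at hb
    simp only [aTl, Matrix.of_apply, Fin.val_last]
    rw [if_neg (by omega), mul_zero]
  · simp

lemma schur_abs (s : ℕ → A) (n : ℕ)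
    (G : Matrix (Fin (n + 2)) (Fin (n + 2)) A) (G' : Matrix (Fin (n + 1)) (Fin (n + 1)) A)
    (hG : aHk s (n + 1) * G = 1) (hG' : G' * aHk s n = 1) :
    (s (2 * (n + 1)) - ∑ j : Fin (n + 1), (∑ i : Fin (n + 1), s (n + 1 + i.1) * G' i j) *
      s (n + 1 + j.1)) * G (Fin.last (n + 1)) (Fin.last (n + 1)) = 1 := by
  set x := G (Fin.last (n + 1)) (Fin.last (n + 1)) with hx
  set X : Fin (n + 1) → A := fun i => G i.castSucc (Fin.last (n + 1)) with hX
  have e1 : ∀ j : Fin (n + 1), ∑ i : Fin (n + 1), aHk s n j i * X i = - (s (n + 1 + j.1) * x) := by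
    intro j
    have := congrFun (congrFun hG j.castSucc) (Fin.last (n + 1))
    rw [Matrix.mul_apply, Fin.sum_univ_castSucc, Matrix.one_apply_ne (Fin.castSucc_lt_last j).ne]
      at this
    rw [eq_neg_iff_add_eq_zero, ← this]
    simp [aHk, hX, hx, add_comm]
  have e2 : ∑ i : Fin (n + 1), s (n + 1 + i.1) * X i + s (2 * (n + 1)) * x = 1 := by
    have := congrFun (congrFun hG (Fin.last (n + 1))) (Fin.last (n + 1))
    rw [Matrix.mul_apply, Fin.sum_univ_castSucc, Matrix.one_apply_eq] at this
    rw [← this]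
    simp [aHk, hX, hx, two_mul]
  have e3 : ∀ i, X i = - ∑ j : Fin (n + 1), G' i j * s (n + 1 + j.1) * x := by
    intro i
    have : X i = ∑ k, (G' * aHk s n) i k * X k := by
      rw [hG']; simp [Matrix.one_apply]
    rw [this]
    simp only [Matrix.mul_apply, Finset.sum_mul]
    rw [Finset.sum_comm, ← Finset.sum_neg_distrib]
    apply Finset.sum_congr rfl
    intro j _
    rw [mul_assoc, ← mul_neg, ← e1, Finset.mul_sum]
    simp only [mul_assoc]
  rw [← e2, sub_mul, sub_eq_add_neg, add_comm]
  congr 1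
  rw [Finset.sum_mul, ← Finset.sum_neg_distrib]
  simp only [e3, mul_neg, Finset.sum_neg_distrib, Finset.mul_sum, Finset.sum_mul]
  rw [Finset.sum_comm]
  simp only [mul_assoc]

end Abstract

section Concrete

variable {q : ℕ}

/-- The ring isomorphism between matrices of blocks and big matrices. -/
abbrev bl (q n : ℕ) :
    Matrix (Fin (n + 1)) (Fin (n + 1)) (Mq q) ≃+*
      Matrix (Fin (n + 1) × Fin q) (Fin (n + 1) × Fin q) ℂ :=
  Matrix.compRingEquiv (Fin (n + 1)) (Fin q) ℂ

lemma Hmat_eq (s : ℕ → Mq q) (n : ℕ) : Hmat q s n = bl q n (aHk s n) := rfl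

lemma Kmat_eq_s4 (s : ℕ → Mq q) (n : ℕ) : Kmat q s n = bl q n (aHk (fun j => s (j + 1)) n) := rfl

lemma Kmat_shift (s : ℕ → Mq q) (n : ℕ) : Kmat q s n = Hmat q (fun j => s (j + 1)) n := rfl

lemma bl_inv {n : ℕ} (B : Matrix (Fin (n + 1)) (Fin (n + 1)) (Mq q)) (h : (bl q n B).PosDef) :
    B * (bl q n).symm (bl q n B)⁻¹ = 1 ∧ (bl q n).symm (bl q n B)⁻¹ * B = 1 := by
  have hu := (Matrix.isUnit_iff_isUnit_det _).1 h.isUnit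
  constructor
  · apply (bl q n).injective
    rw [map_mul, RingEquiv.apply_symm_apply, map_one, Matrix.mul_nonsing_inv _ hu]
  · apply (bl q n).injective
    rw [map_mul, RingEquiv.apply_symm_apply, map_one, Matrix.nonsing_inv_mul _ hu]

lemma vcol_form (n : ℕ) (X : Matrix (Fin (n + 1) × Fin q) (Fin (n + 1) × Fin q) ℂ) :
    (vcol q n)ᴴ * X * vcol q n = (bl q n).symm X 0 0 := by
  ext a b
  rw [Matrix.mul_apply, Finset.sum_eq_single ((0 : Fin (n + 1)), b)]
  · rw [Matrix.mul_apply, Finset.sum_eq_single ((0 : Fin (n + 1)), a)]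
    · simp [vcol]
    · rintro ⟨i, c⟩ _ hne
      have : ¬ (i.1 = 0 ∧ c = a) := by
        rintro ⟨h1, h2⟩
        exact hne (Prod.ext (Fin.ext h1) h2)
      simp only [vcol, Matrix.conjTranspose_apply, Matrix.of_apply]
      rw [if_neg this, star_zero, zero_mul]
    · simp
  · rintro ⟨i, c⟩ _ hne
    have : ¬ (i.1 = 0 ∧ c = b) := by
      rintro ⟨h1, h2⟩
      exact hne (Prod.ext (Fin.ext h1) h2)
    simp only [vcol, Matrix.of_apply]
    rw [if_neg this, mul_zero]
  · simp

lemma row_form (n : ℕ) (X : Matrix (Fin (n + 1) × Fin q) (Fin (n + 1) × Fin q) ℂ)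
    (f g : ℕ → Mq q) :
    (Matrix.of fun (a : Fin q) (r : Fin (n + 1) × Fin q) => f r.1.1 a r.2) * X *
      (Matrix.of fun (p : Fin (n + 1) × Fin q) (b : Fin q) => g p.1.1 p.2 b)
    = ∑ j : Fin (n + 1), (∑ i : Fin (n + 1), f i.1 * (bl q n).symm X i j) * g j.1 := by
  ext a b
  simp only [Matrix.sum_apply, Matrix.mul_apply, Matrix.of_apply, Fintype.sum_prod_type]
  rfl

lemma ycol_form (n : ℕ) (X : Matrix (Fin (n + 1) × Fin q) (Fin (n + 1) × Fin q) ℂ)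
    (s : ℕ → Mq q) (hs : ∀ j, (s j)ᴴ = s j) :
    (ycol q s n)ᴴ * X * ycol q s n
    = ∑ i : Fin (n + 1), ∑ j : Fin (n + 1), s i.1 * (bl q n).symm X i j * s j.1 := by
  have : (ycol q s n)ᴴ = (Matrix.of fun (a : Fin q) (r : Fin (n + 1) × Fin q) => s r.1.1 a r.2) := by
    ext a r
    exact congrFun (congrFun (hs r.1.1) a) r.2
  rw [this]
  refine (row_form n X s s).trans ?_
  rw [Finset.sum_comm]
  simp only [Finset.sum_mul]

lemma herm_of_PD (s : ℕ → Mq q) (hs : IsStieltjesPD q s) (j : ℕ) : (s j)ᴴ = s j := by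
  ext a b
  have := ((hs j).1.1).apply (0, a) (Fin.last j, b)
  simpa [Hmat] using this

lemma unit_zero (s : ℕ → Mq q) (hs : IsStieltjesPD q s) : IsUnit (s 0).det := by
  have h : s 0 = (Hmat q s 0).submatrix (fun a => ((0 : Fin 1), a)) (fun a => ((0 : Fin 1), a)) := rfl
  have : (s 0).PosDef := by
    rw [h]
    apply (hs 0).1.submatrix
    intro a b hab
    exact (Prod.ext_iff.1 hab).2
  exact (Matrix.isUnit_iff_isUnit_det _).1 this.isUnit

lemma rec_conv (s : ℕ → Mq q) (h0 : IsUnit (s 0).det) : aConv s (reciprocal q s) := by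
  intro n
  cases n with
  | zero => simp [reciprocal, Matrix.mul_nonsing_inv _ h0]
  | succ n =>
    rw [Finset.sum_range_succ', if_neg (by omega), Nat.sub_zero, reciprocal, neg_mul, mul_neg,
      ← mul_assoc, Matrix.mul_nonsing_inv _ h0, one_mul, ← sub_eq_add_neg, sub_eq_zero,
      Finset.sum_attach (Finset.range (n + 1)) (fun l => s (n + 1 - l) * reciprocal q s l),
      ← Finset.sum_range_reflect]
    apply Finset.sum_congr rfl
    intro a ha
    rw [Finset.mem_range] at ha
    congr 2 <;> omega

lemma rec_herm (s : ℕ → Mq q) (hs : IsStieltjesPD q s) :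
    aConv (reciprocal q s) s ∧ ∀ j, (reciprocal q s j)ᴴ = reciprocal q s j := by
  have h1 := rec_conv s (unit_zero s hs)
  have h2 : aConv (fun j => (reciprocal q s j)ᴴ) s := by
    intro n
    have := congrArg Matrix.conjTranspose (h1 n)
    rw [Matrix.conjTranspose_sum, ← Finset.sum_range_reflect] at this
    have e : (if n = 0 then (1 : Mq q) else 0)ᴴ = if n = 0 then 1 else 0 := by
      split_ifs <;> simp
    rw [e] at this
    rw [← this]
    apply Finset.sum_congr rfl
    intro a ha
    rw [Finset.mem_range] at ha
    rw [Matrix.conjTranspose_mul, herm_of_PD s hs]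
    congr 3 <;> omega
  have h3 : ∀ j, (reciprocal q s j)ᴴ = reciprocal q s j := by
    intro j
    have := left_inv_eq_right_inv (aTl_mul _ _ h2 j) (aTl_mul _ _ h1 j)
    have := congrFun (congrFun this (Fin.last j)) 0
    simpa [aTl] using this
  refine ⟨?_, h3⟩
  simpa only [h3] using h2

lemma katetov1_eq (s : ℕ → Mq q) : katetov1 q s = aT s (reciprocal q s) := rfl

lemma bl_tl_star (r : ℕ → Mq q) (hr : ∀ j, (r j)ᴴ = r j) (n : ℕ) :
    (bl q n (aTl r n))ᴴ = bl q n (aTu r n) := by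
  ext ⟨i, a⟩ ⟨j, b⟩
  change star ((aTl r n) j i b a) = (aTu r n) i j a b
  simp only [aTl, aTu, Matrix.of_apply]
  split_ifs
  · exact congrFun (congrFun (hr _) a) b
  · simp

lemma bl_sc_star (a : Mq q) (ha : aᴴ = a) (n : ℕ) :
    (bl q n (aSc a n))ᴴ = bl q n (aSc a n) := by
  ext ⟨i, c⟩ ⟨j, b⟩
  change star ((aSc a n) j i b c) = (aSc a n) i j c b
  simp only [aSc, Matrix.diagonal_apply]
  by_cases h : i = j
  · rw [if_pos h, if_pos h.symm]
    exact congrFun (congrFun ha c) b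
  · rw [if_neg h, if_neg (Ne.symm h)]
    simp

lemma PD_congr {n : ℕ} (X C D : Matrix (Fin (n + 1)) (Fin (n + 1)) (Mq q))
    (hX : (bl q n X).PosDef) (hC : IsUnit C) (hD : (bl q n C)ᴴ = bl q n D) :
    (bl q n (C * X * D)).PosDef := by
  rw [map_mul, map_mul, ← hD]
  apply hX.mul_mul_conjTranspose_same
  rw [Matrix.vecMul_injective_iff_isUnit]
  exact hC.map (bl q n)

lemma isUnit_aTl (s r : ℕ → Mq q) (hsr : aConv s r) (hrs : aConv r s) (n : ℕ) :
    IsUnit (aTl r n) :=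
  ⟨⟨aTl r n, aTl s n, aTl_mul r s hrs n, aTl_mul s r hsr n⟩, rfl⟩

lemma isUnit_aSc (a b : Mq q) (hab : a * b = 1) (hba : b * a = 1) (n : ℕ) :
    IsUnit (aSc a n) :=
  ⟨⟨aSc a n, aSc b n, by rw [Matrix.diagonal_mul_diagonal, hab, Matrix.diagonal_one],
    by rw [Matrix.diagonal_mul_diagonal, hba, Matrix.diagonal_one]⟩, rfl⟩

lemma katetov1_PD (s : ℕ → Mq q) (hs : IsStieltjesPD q s) : IsStieltjesPD q (katetov1 q s) := by
  intro n
  have hsr := rec_conv s (unit_zero s hs)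
  obtain ⟨hrs, hr⟩ := rec_herm s hs
  have h0 := conv_zero _ _ hsr
  have h0' := conv_zero _ _ hrs
  have hsh := herm_of_PD s hs
  have uS := isUnit_aSc _ _ h0 h0' n
  constructor
  · rw [Hmat_eq, katetov1_eq, aHk_aT _ _ hrs hsr]
    apply PD_congr
    · exact (hs n).2
    · exact uS.mul (isUnit_aTl _ _ hsr hrs n)
    · rw [map_mul, Matrix.conjTranspose_mul, bl_tl_star _ hr, bl_sc_star _ (hsh 0), map_mul]
  · rw [Kmat_eq_s4, katetov1_eq, aHk_aT1]
    apply PD_congr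
    · have h1 : (bl q (n + 1) (aDg (reciprocal q s 0)
          (- aHk (fun j => reciprocal q s (j + 2)) n))).PosDef := by
        rw [aDg_eq _ _ hrs hsr]
        apply PD_congr
        · exact (hs (n + 1)).1
        · exact isUnit_aTl _ _ hsr hrs (n + 1)
        · exact bl_tl_star _ hr _
      have h2 := h1.submatrix (e := fun p : Fin (n + 1) × Fin q => (p.1.succ, p.2)) (by
        intro p p' hpp
        rw [Prod.ext_iff] at hpp
        exact Prod.ext (Fin.succ_injective _ hpp.1) hpp.2)
      exact h2
    · exact uS
    · exact bl_sc_star _ (hsh 0) n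

/-- Inverse block matrix of the Hankel matrix. -/
def Hi (q : ℕ) (s : ℕ → Mq q) (n : ℕ) : Matrix (Fin (n + 1)) (Fin (n + 1)) (Mq q) :=
  (bl q n).symm (Hmat q s n)⁻¹

lemma Hi_spec (s : ℕ → Mq q) (hs : ∀ n, (Hmat q s n).PosDef) (n : ℕ) :
    aHk s n * Hi q s n = 1 ∧ Hi q s n * aHk s n = 1 :=
  bl_inv _ (hs n)

lemma Hi_zero (s : ℕ → Mq q) (hs : ∀ n, (Hmat q s n).PosDef) :
    Hi q s 0 0 0 = (s 0)⁻¹ ∧ s 0 * Hi q s 0 0 0 = 1 := by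
  have h := congrFun (congrFun (Hi_spec s hs 0).1 0) 0
  have h' : s 0 * Hi q s 0 0 0 = 1 := by
    simpa [Matrix.mul_apply, aHk] using h
  exact ⟨(Matrix.inv_eq_right_inv h').symm, h'⟩

/-- Sum form of `𝔏`. -/
lemma DSL_partial (s : ℕ → Mq q) (hs : IsStieltjesPD q s) (k : ℕ) :
    (ycol q s k)ᴴ * (Kmat q s k)⁻¹ * ycol q s k
      = ∑ i : Fin (k + 1), ∑ j : Fin (k + 1), s i.1 * Hi q (fun j => s (j + 1)) k i j * s j.1 :=
  ycol_form k _ s (herm_of_PD s hs)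

lemma DSL_zero (s : ℕ → Mq q) (hs : IsStieltjesPD q s) :
    DSL q s 0 = (ycol q s 0)ᴴ * (Kmat q s 0)⁻¹ * ycol q s 0 := by
  rw [DSL_partial s hs]
  simp [DSL, (Hi_zero (fun j => s (j + 1)) (fun n => (hs n).2)).1]

lemma DSM_zero (s : ℕ → Mq q) (hs : IsStieltjesPD q s) :
    DSM q s 0 = (vcol q 0)ᴴ * (Hmat q s 0)⁻¹ * vcol q 0 := by
  rw [vcol_form]
  exact (Hi_zero s (fun n => (hs n).1)).1.symm

lemma M_conc (s : ℕ → Mq q) (hs : IsStieltjesPD q s) (k : ℕ) :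
    (vcol q k)ᴴ * (Hmat q (katetov1 q s) k)⁻¹ * vcol q k
      = (s 0)⁻¹ * ((ycol q s k)ᴴ * (Kmat q s k)⁻¹ * ycol q s k) * (s 0)⁻¹ := by
  have hsr := rec_conv s (unit_zero s hs)
  obtain ⟨hrs, hr⟩ := rec_herm s hs
  have hr0 : reciprocal q s 0 = (s 0)⁻¹ := by rw [reciprocal]
  have ht := katetov1_PD s hs
  rw [DSL_partial s hs, vcol_form, ← hr0]
  exact M_trans s _ hrs hsr k _ _ (Hi_spec (fun j => s (j + 1)) (fun n => (hs n).2) k).1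
    (Hi_spec _ (fun n => (ht n).1) k).2

lemma L_conc (s : ℕ → Mq q) (hs : IsStieltjesPD q s) (k : ℕ) :
    (ycol q (katetov1 q s) k)ᴴ * (Kmat q (katetov1 q s) k)⁻¹ * ycol q (katetov1 q s) k
      = s 0 * ((vcol q (k + 1))ᴴ * (Hmat q s (k + 1))⁻¹ * vcol q (k + 1) - (s 0)⁻¹) * s 0 := by
  have hsr := rec_conv s (unit_zero s hs)
  obtain ⟨hrs, hr⟩ := rec_herm s hs
  have hr0 : reciprocal q s 0 = (s 0)⁻¹ := by rw [reciprocal]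
  have ht := katetov1_PD s hs
  rw [DSL_partial _ ht, vcol_form, ← hr0]
  exact L_trans s _ hrs hsr k _ _ (Hi_spec s (fun n => (hs n).1) (k + 1)).2
    (Hi_spec (fun j => katetov1 q s (j + 1)) (fun n => (ht n).2) k).1

lemma one_step (s : ℕ → Mq q) (hs : IsStieltjesPD q s) (k : ℕ) :
    DSL q (katetov1 q s) k = s 0 * DSM q s (k + 1) * s 0 ∧
      DSM q (katetov1 q s) k = (s 0)⁻¹ * DSL q s k * (s 0)⁻¹ := by
  have ht := katetov1_PD s hs
  cases k with
  | zero =>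
    constructor
    · rw [DSL_zero _ ht, L_conc s hs, DSM, ← DSM_zero s hs, DSM]
    · rw [DSM_zero _ ht, M_conc s hs, ← DSL_zero s hs]
  | succ k =>
    constructor
    · rw [DSL, L_conc s hs, L_conc s hs, DSM]
      noncomm_ring
    · rw [DSM, M_conc s hs, M_conc s hs, DSL]
      noncomm_ring

lemma qEven_spec (s : ℕ → Mq q) (hs : ∀ n, (Hmat q s n).PosDef) (k : ℕ) :
    qEven q s k * Hi q s k (Fin.last k) (Fin.last k) = 1 := by
  cases k with
  | zero => exact (Hi_zero s hs).2
  | succ k =>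
    rw [← schur_abs s k (Hi q s (k + 1)) (Hi q s k) (Hi_spec s hs _).1 (Hi_spec s hs _).2]
    congr 1
    rw [qEven]
    congr 1
    exact row_form k _ (fun i => s (k + 1 + i)) (fun i => s (k + 1 + i))

lemma qEven_eq_s4 (s : ℕ → Mq q) (hs : ∀ n, (Hmat q s n).PosDef) (k : ℕ) :
    qEven q s k = (Hi q s k (Fin.last k) (Fin.last k))⁻¹ :=
  (Matrix.inv_eq_left_inv (qEven_spec s hs k)).symm

lemma qOdd_shift (s : ℕ → Mq q) (k : ℕ) : qOdd q s k = qEven q (fun j => s (j + 1)) k := by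
  cases k with
  | zero => rfl
  | succ k =>
    simp only [qOdd, qEven, Kmat_shift]
    simp only [show ∀ i, k + 1 + i + 1 = k + 2 + i by intro i; ring]

lemma q_even_step (s : ℕ → Mq q) (hs : IsStieltjesPD q s) (k : ℕ) :
    qEven q (katetov1 q s) k = qOdd q s k := by
  have hsr := rec_conv s (unit_zero s hs)
  obtain ⟨hrs, hr⟩ := rec_herm s hs
  have ht := katetov1_PD s hs
  rw [qOdd_shift, qEven_eq_s4 _ (fun n => (ht n).1), qEven_eq_s4 (fun j => s (j + 1)) (fun n => (hs n).2)]
  congr 1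
  exact q_trans_one s _ hrs hsr k _ _ (Hi_spec (fun j => s (j + 1)) (fun n => (hs n).2) k).1
    (Hi_spec _ (fun n => (ht n).1) k).2

lemma q_odd_step (s : ℕ → Mq q) (hs : IsStieltjesPD q s) (k : ℕ) :
    qOdd q (katetov1 q s) k = qEven q s (k + 1) := by
  have hsr := rec_conv s (unit_zero s hs)
  obtain ⟨hrs, hr⟩ := rec_herm s hs
  have ht := katetov1_PD s hs
  rw [qOdd_shift, qEven_eq_s4 (fun j => katetov1 q s (j + 1)) (fun n => (ht n).2), qEven_eq_s4 _ (fun n => (hs n).1)]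
  congr 1
  exact (q_trans_two s _ hrs hsr k _ _ (Hi_spec s (fun n => (hs n).1) (k + 1)).2
    (Hi_spec (fun j => katetov1 q s (j + 1)) (fun n => (ht n).2) k).1).symm

lemma qpar_step (s : ℕ → Mq q) (hs : IsStieltjesPD q s) (j : ℕ) :
    qpar q (katetov1 q s) j = qpar q s (j + 1) := by
  unfold qpar
  by_cases h : j % 2 = 0
  · rw [if_pos h, if_neg (by omega), q_even_step s hs, show (j + 1) / 2 = j / 2 by omega]
  · rw [if_neg h, if_pos (by omega), q_odd_step s hs, show (j + 1) / 2 = j / 2 + 1 by omega]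

lemma katetov_all (ℓ : ℕ) : ∀ (s : ℕ → Mq q), IsStieltjesPD q s →
    IsStieltjesPD q (katetov q ℓ s) ∧ qpar q s ℓ = katetov q ℓ s 0 := by
  induction ℓ with
  | zero => exact fun s hs => ⟨hs, rfl⟩
  | succ ℓ ih =>
    intro s hs
    have := ih (katetov1 q s) (katetov1_PD s hs)
    rw [qpar_step s hs] at this
    exact this

end Concrete

/-- `𝔏_k^{(ℓ+1)} = 𝔮_ℓ 𝔐_{k+1}^{(ℓ)} 𝔮_ℓ` and `𝔐_k^{(ℓ+1)} = 𝔮_ℓ⁻¹ 𝔏_k^{(ℓ)} 𝔮_ℓ⁻¹`. -/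
theorem stmt4 (q : ℕ) (hq : 1 ≤ q) (s : ℕ → Mq q) (hs : IsStieltjesPD q s) (ℓ k : ℕ) :
    DSL q (katetov q (ℓ + 1) s) k = qpar q s ℓ * DSM q (katetov q ℓ s) (k + 1) * qpar q s ℓ ∧
      DSM q (katetov q (ℓ + 1) s) k =
        (qpar q s ℓ)⁻¹ * DSL q (katetov q ℓ s) k * (qpar q s ℓ)⁻¹ := by
  obtain ⟨h1, h2⟩ := katetov_all ℓ s hs
  have h3 : katetov q (ℓ + 1) s = katetov1 q (katetov q ℓ s) :=
    Function.iterate_succ_apply' _ _ _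
  rw [h2, h3]
  exact one_step _ h1 k

end
end
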